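/- arXiv:2101.09881 — 2 statements merged into one kernel-verified Lean document; each statement's English description precedes it below -/
import Mathlib

section
/- Let 𝒫 be a class of stably finite unital C*-algebras such that for every B ∈ 𝒫 the Cuntz semigroup W(B) is almost unperforated. Then W(A) is almost unperforated for every simple unital C*-algebra A that is asymptotically tracially in 𝒫. -/
open Filter Topology Matrix

/-- Cuntz subequivalence for matrices over a topological *-ring. -/
def MatCuntzLE {R : Type} [NonUnitalRing R] [StarRing R] [TopologicalSpace R]
    {ι κ : Type} [Fintype ι] [Fintype κ] (a : Matrix ι ι R) (b : Matrix κ κ R) : Prop :=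
  ∃ v : ℕ → Matrix ι κ R,
    Filter.Tendsto (fun k => v k * b * (v k)ᴴ) Filter.atTop (nhds a)

/-- Positivity of a matrix over a C*-algebra: `a = cᴴ * c` for some `c`. -/
def MatPos {R : Type} [NonUnitalRing R] [StarRing R] {ι : Type} [Fintype ι]
    (a : Matrix ι ι R) : Prop :=
  ∃ c : Matrix ι ι R, a = cᴴ * c

/-- The `k`-fold direct sum `a ⊕ ⋯ ⊕ a`, representing `k⟨a⟩` in the Cuntz semigroup. -/
def matRep {R : Type} [NonUnitalRing R] {ι : Type} (k : ℕ) (a : Matrix ι ι R) :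
    Matrix (ι × Fin k) (ι × Fin k) R :=
  Matrix.blockDiagonal fun _ : Fin k => a

/-- `β`-comparison in the sense of Kirchberg–Rørdam. -/
def BetaComparison (R : Type) [NonUnitalRing R] [StarRing R] [TopologicalSpace R] (β : ℝ) : Prop :=
  ∀ (n m k l : ℕ), 1 ≤ k → 1 ≤ l → β * (l : ℝ) < (k : ℝ) →
    ∀ (a : Matrix (Fin n) (Fin n) R) (b : Matrix (Fin m) (Fin m) R),
      MatPos a → MatPos b → MatCuntzLE (matRep k a) (matRep l b) → MatCuntzLE a b

/-- `n`-comparison in the sense of Winter. -/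
def NComparison (R : Type) [NonUnitalRing R] [StarRing R] [TopologicalSpace R] (N : ℕ) : Prop :=
  ∀ (na : ℕ) (mb : Fin (N + 1) → ℕ)
    (a : Matrix (Fin na) (Fin na) R) (b : ∀ j, Matrix (Fin (mb j)) (Fin (mb j)) R),
    MatPos a → (∀ j, MatPos (b j)) →
    (∀ j, ∃ k : ℕ, 1 ≤ k ∧ MatCuntzLE (matRep (k + 1) a) (matRep k (b j))) →
    MatCuntzLE a (Matrix.blockDiagonal' b)

/-- Almost unperforation of the Cuntz semigroup `W(R)`. -/
def AlmostUnperforatedW (R : Type) [NonUnitalRing R] [StarRing R] [TopologicalSpace R] : Prop :=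
  ∀ (n m : ℕ) (a : Matrix (Fin n) (Fin n) R) (b : Matrix (Fin m) (Fin m) R),
    MatPos a → MatPos b →
    ∀ k : ℕ, 1 ≤ k → MatCuntzLE (matRep (k + 1) a) (matRep k b) → MatCuntzLE a b

/-- Stable finiteness: every isometry in every matrix algebra is a unitary. -/
def StablyFinite (R : Type) [Ring R] [StarRing R] : Prop :=
  ∀ (n : ℕ) (v : Matrix (Fin n) (Fin n) R), vᴴ * v = 1 → v * vᴴ = 1



/-- Cuntz subequivalence for elements of a C*-algebra. -/
def CuntzLE {A : Type} [Mul A] [Star A] [TopologicalSpace A] (a b : A) : Prop :=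
  ∃ v : ℕ → A, Filter.Tendsto (fun k => v k * b * star (v k)) Filter.atTop (nhds a)

/-- A completely positive contractive linear map between C*-algebras. -/
def IsCPC {A B : Type} [NonUnitalCStarAlgebra A] [NonUnitalCStarAlgebra B]
    [NormedSpace ℂ A] [NormedSpace ℂ B] [StarModule ℂ A] [StarModule ℂ B]
    (φ : A →ₗ[ℂ] B) : Prop :=
  (∀ x, ‖φ x‖ ≤ ‖x‖) ∧
    ∀ (n : ℕ) (a : Matrix (Fin n) (Fin n) A), MatPos a → MatPos (a.map φ)

/-- A bundled unital C*-algebra. -/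
structure BundledCStarAlgebra : Type 1 where
  carrier : Type
  [str : CStarAlgebra carrier]

attribute [instance] BundledCStarAlgebra.str

/-- A unital C*-algebra is (topologically) simple if its only closed two-sided ideals
are trivial. -/
def IsSimpleCStarAlgebra (A : Type) [CStarAlgebra A] : Prop :=
  ∀ I : TwoSidedIdeal A, IsClosed (I : Set A) → I = ⊥ ∨ I = ⊤


/-- Definition (Fu–Lin): `A` is asymptotically tracially in the class `P`. -/
def AsympTraciallyIn (P : BundledCStarAlgebra → Prop) (A : Type) [CStarAlgebra A] : Prop :=
  ∀ (ε : ℝ), 0 < ε → ∀ (F : Finset A) (c : A), (∃ d : A, c = star d * d) → c ≠ 0 →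
    ∃ B : BundledCStarAlgebra, P B ∧
      ∃ (α : A →ₗ[ℂ] B.carrier) (βn : ℕ → (B.carrier →ₗ[ℂ] A)) (γn : ℕ → (A →ₗ[ℂ] A)),
        IsCPC α ∧ (∀ n, IsCPC (βn n)) ∧ (∀ n, IsCPC (γn n)) ∧
        -- each `γn` maps into `A ∩ βn(B)^⊥`
        (∀ (n : ℕ) (x : A) (b : B.carrier),
          γn n x * βn n b = 0 ∧ βn n b * γn n x = 0) ∧
        -- (1)
        α 1 = 1 ∧
        (∀ n : ℕ, IsIdempotentElem (βn n 1) ∧ IsSelfAdjoint (βn n 1) ∧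
          IsIdempotentElem (γn n 1) ∧ IsSelfAdjoint (γn n 1) ∧
          βn n 1 + γn n 1 = 1) ∧
        -- (2)
        (∀ x ∈ F, ∀ n : ℕ, ‖x - γn n x - βn n (α x)‖ < ε) ∧
        -- (3) `α` is an `F`-`ε` approximate embedding
        (∀ x ∈ F, ∀ y ∈ F, ‖α x * α y - α (x * y)‖ < ε) ∧
        (∀ x ∈ F, ‖x‖ - ε ≤ ‖α x‖) ∧
        -- (4)
        (∀ x y : B.carrier,
          Filter.Tendsto (fun n => ‖βn n (x * y) - βn n x * βn n y‖) Filter.atTop (nhds 0) ∧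
          Filter.Tendsto (fun n => ‖βn n x‖) Filter.atTop (nhds ‖x‖)) ∧
        -- (5)
        (∀ n : ℕ, CuntzLE (γn n 1) c)

section G
variable {C : Type} [CStarAlgebra C] [PartialOrder C] [StarOrderedRing C]

theorem g_norm_conj_le {u x k : C} (hu : 0 ≤ u) (h : u ≤ x) (hk : IsSelfAdjoint k) :
    ‖k * u * k‖ ≤ ‖k * x * k‖ := by
  apply CStarAlgebra.norm_le_norm_of_nonneg_of_le
  · exact hk.conjugate_nonneg hu
  · exact hk.conjugate_le_conjugate h

theorem g_cuntz {u x : C} (hu : 0 ≤ u) (h : u ≤ x) {τ : ℝ} (hτ : 0 < τ) :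
    ∃ v : C, ‖v * x * star v - u‖ ≤ τ := by
  have hx : 0 ≤ x := hu.trans h
  have hxs : IsSelfAdjoint x := .of_nonneg hx
  have hspec : ∀ s ∈ spectrum ℝ x, 0 ≤ s := fun s hs => spectrum_nonneg_of_nonneg hx hs
  set kf : ℝ → ℝ := fun s => Real.sqrt (τ / (s + τ)) with hkf
  have hkc : ContinuousOn kf (spectrum ℝ x) := by
    refine Continuous.comp_continuousOn Real.continuous_sqrt ?_
    refine ContinuousOn.div continuousOn_const (by fun_prop) ?_
    intro s hs
    have := hspec s hs
    positivity
  have hsq : ∀ s ∈ spectrum ℝ x, kf s * kf s = τ / (s + τ) := fun s hs => by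
    have := hspec s hs
    exact Real.mul_self_sqrt (by positivity)
  set k := cfc kf x with hk
  have hks : IsSelfAdjoint k := cfc_predicate _ _
  have e1 : k * x * k = cfc (fun s => kf s * s * kf s) x := by
    conv_lhs => rw [hk]
    conv_lhs => enter [1, 2]; rw [← cfc_id' ℝ x]
    rw [← cfc_mul kf _ x, ← cfc_mul _ _ x]
  have e2 : k * x * k = (τ : ℂ) • (1 - k * k) := by
    rw [e1, hk, ← cfc_mul kf kf x, ← cfc_one (R := ℝ) x, ← cfc_sub _ _ x, Complex.coe_smul,
      ← cfc_smul _ _ x]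
    apply cfc_congr
    intro s hs
    have := hspec s hs
    have h2 := hsq s hs
    simp only [smul_eq_mul, Pi.one_apply]
    rw [mul_right_comm, h2]
    field_simp
    ring
  have e3 : ‖k * x * k‖ ≤ τ := by
    rw [e1]
    apply norm_cfc_le hτ.le
    intro s hs
    have := hspec s hs
    have h2 := hsq s hs
    rw [mul_right_comm, h2, Real.norm_of_nonneg (by positivity), div_mul_eq_mul_div, div_le_iff₀ (by positivity)]
    nlinarith
  have hss : IsSelfAdjoint (CFC.sqrt u) := .of_nonneg (CFC.sqrt_nonneg u)
  have htt : CFC.sqrt u * CFC.sqrt u = u := CFC.sqrt_mul_sqrt_self u hu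
  set t := CFC.sqrt u
  refine ⟨((Real.sqrt τ)⁻¹ : ℂ) • (t * k), ?_⟩
  have : ((Real.sqrt τ)⁻¹ : ℂ) * ((Real.sqrt τ)⁻¹ : ℂ) * (τ : ℂ) = 1 := by
    norm_cast
    rw [← mul_inv, Real.mul_self_sqrt hτ.le, inv_mul_cancel₀ hτ.ne']
  have e4 : ((Real.sqrt τ)⁻¹ : ℂ) • (t * k) * x * star (((Real.sqrt τ)⁻¹ : ℂ) • (t * k)) - u
      = - ((t * k) * star (t * k)) := by
    have hst : star (((Real.sqrt τ)⁻¹ : ℂ)) = ((Real.sqrt τ)⁻¹ : ℂ) := by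
      simp
    rw [star_smul, hst, star_mul, hks.star_eq, hss.star_eq]
    have : ((Real.sqrt τ)⁻¹ : ℂ) • (t * k) * x * (((Real.sqrt τ)⁻¹ : ℂ) • (k * t)) =
       t * ((((Real.sqrt τ)⁻¹ : ℂ) * ((Real.sqrt τ)⁻¹ : ℂ)) • (k * x * k)) * t := by
      simp only [smul_mul_assoc, mul_smul_comm, smul_smul, mul_assoc]
    rw [this, e2, smul_smul, ‹_ * _ * (τ : ℂ) = 1›, one_smul]
    conv_lhs => rw [← htt]
    noncomm_ring
  rw [e4, norm_neg, CStarRing.norm_self_mul_star, ← CStarRing.norm_star_mul_self]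
  rw [star_mul, hks.star_eq, hss.star_eq]
  have : k * t * (t * k) = k * u * k := by rw [← htt]; noncomm_ring
  rw [this]
  exact (g_norm_conj_le hu h hks).trans e3

theorem g_cut {x : C} (hx : 0 ≤ x) {δ : ℝ} (hδ : 0 < δ) :
    ∃ r : C, IsSelfAdjoint r ∧ 0 ≤ r * (x - (δ : ℂ) • 1) * r ∧
      ‖x - r * (x - (δ : ℂ) • 1) * r‖ ≤ 2 * δ := by
  have hxs : IsSelfAdjoint x := .of_nonneg hx
  have hspec : ∀ s ∈ spectrum ℝ x, 0 ≤ s := fun s hs => spectrum_nonneg_of_nonneg hx hs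
  set f : ℝ → ℝ := fun s => min 1 (max 0 ((s - δ) / δ)) with hf
  have hfc : Continuous f := by fun_prop
  have e : cfc f x * (x - (δ : ℂ) • 1) * cfc f x = cfc (fun s => f s * (s - δ) * f s) x := by
    have : x - (δ : ℂ) • 1 = cfc (fun s : ℝ => s - δ) x := by
      rw [cfc_sub _ _ x, cfc_id' ℝ x, cfc_const δ x, Complex.coe_smul, Algebra.algebraMap_eq_smul_one]
    rw [this, ← cfc_mul _ _ x, ← cfc_mul _ _ x]
  have key : ∀ s : ℝ, 0 ≤ s → 0 ≤ f s * (s - δ) * f s ∧ |s - f s * (s - δ) * f s| ≤ 2 * δ := by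
    intro s hs
    have h1 : 0 ≤ f s := le_min (by norm_num) (le_max_left _ _)
    have h2 : f s ≤ 1 := min_le_left _ _
    rcases le_total s δ with h | h
    · have : f s = 0 := by
        simp only [hf]
        rw [max_eq_left (div_nonpos_of_nonpos_of_nonneg (by linarith) hδ.le)]
        norm_num
      rw [this]; simp [abs_of_nonneg hs]; linarith
    · have h3 : 0 ≤ f s * (s - δ) * f s := by
        have : 0 ≤ s - δ := by linarith
        positivity
      refine ⟨h3, ?_⟩
      have h4 : f s * (s - δ) * f s ≤ s - δ := by
        have : 0 ≤ s - δ := by linarith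
        nlinarith [mul_nonneg h1 this, mul_nonneg (sub_nonneg.2 h2) this]
      rw [abs_of_nonneg (by linarith)]
      rcases le_total s (2 * δ) with h' | h'
      · linarith
      · have : f s = 1 := by
          simp only [hf]
          rw [min_eq_left]
          apply le_max_of_le_right
          rw [le_div_iff₀ hδ]; linarith
        rw [this]; linarith
  refine ⟨cfc f x, cfc_predicate _ _, ?_, ?_⟩
  · rw [e]
    exact cfc_nonneg fun s hs => (key s (hspec s hs)).1
  · rw [e]
    conv_lhs => enter [1, 1]; rw [← cfc_id' ℝ x]
    rw [← cfc_sub _ _ x]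
    exact norm_cfc_le (by positivity) fun s hs => (key s (hspec s hs)).2

theorem g_bumps {h : C} (hh : IsSelfAdjoint h) (hn : ¬ ∃ ν : ℝ, h * h = (ν : ℂ) • h) :
    ∃ f g : C, IsSelfAdjoint f ∧ IsSelfAdjoint g ∧ f * g = 0 ∧ f * h = h * f ∧ g * h = h * g ∧
      f * h ≠ 0 ∧ g * h ≠ 0 := by
  have hex : ∃ a ∈ spectrum ℝ h, ∃ b ∈ spectrum ℝ h, a ≠ 0 ∧ b ≠ 0 ∧ a ≠ b := by
    by_contra hcon
    push Not at hcon
    apply hn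
    have : ∃ ν : ℝ, ∀ s ∈ spectrum ℝ h, s * s = ν * s := by
      by_cases h0 : ∃ ν ∈ spectrum ℝ h, ν ≠ 0
      · obtain ⟨ν, h1, h2⟩ := h0
        refine ⟨ν, fun s hs => ?_⟩
        by_cases h3 : s = 0
        · simp [h3]
        · rw [hcon ν h1 s hs h2 h3]
      · push Not at h0
        exact ⟨0, fun s hs => by simp [h0 s hs]⟩
    obtain ⟨ν, hν⟩ := this
    refine ⟨ν, ?_⟩
    rw [Complex.coe_smul]
    conv_lhs => rw [← cfc_id' ℝ h]
    conv_rhs => rw [← cfc_id' ℝ h]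
    rw [← cfc_mul _ _ h, ← cfc_smul _ _ h]
    exact cfc_congr fun s hs => hν s hs
  obtain ⟨a, ha, b, hb, ha0, hb0, hab⟩ := hex
  have hd : 0 < |a - b| := abs_pos.2 (sub_ne_zero.2 hab)
  let φ : ℝ → ℝ → ℝ := fun c s => max 0 (|a - b| / 2 - |s - c|)
  have hφ : ∀ c, Continuous (φ c) := fun c => by fun_prop
  have hcomm : ∀ c, cfc (φ c) h * h = cfc (fun s => φ c s * s) h := fun c => by
    conv_lhs => enter [2]; rw [← cfc_id' ℝ h]
    rw [← cfc_mul _ _ h (hφ c).continuousOn]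
  have hcomm' : ∀ c, h * cfc (φ c) h = cfc (fun s => φ c s * s) h := fun c => by
    conv_lhs => enter [1]; rw [← cfc_id' ℝ h]
    rw [← cfc_mul _ _ h (by fun_prop) (hφ c).continuousOn]
    simp only [mul_comm]
  have hne : ∀ c ∈ spectrum ℝ h, c ≠ 0 → cfc (φ c) h * h ≠ 0 := by
    intro c hc hc0 h0
    rw [hcomm c] at h0
    have hm : φ c c * c ∈ spectrum ℝ (cfc (fun s => φ c s * s) h) := by
      rw [cfc_map_spectrum (fun s => φ c s * s) h hh (((hφ c).mul continuous_id).continuousOn)]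
      exact ⟨c, hc, rfl⟩
    rw [h0] at hm
    have : Nontrivial C := by
      by_contra hnt
      rw [not_nontrivial_iff_subsingleton] at hnt
      simp at hm
    rw [spectrum.zero_eq] at hm
    simp [φ, hc0] at hm
    linarith
  refine ⟨cfc (φ a) h, cfc (φ b) h, cfc_predicate _ _, cfc_predicate _ _, ?_, ?_, ?_,
    hne a ha ha0, hne b hb hb0⟩
  · rw [← cfc_mul _ _ h (hφ a).continuousOn (hφ b).continuousOn]
    rw [← cfc_zero ℝ h]
    apply cfc_congr
    intro s _
    simp only [φ, Pi.zero_apply]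
    by_contra hne0
    have h1 : |a - b| / 2 - |s - a| > 0 := by
      by_contra hle; apply hne0; rw [max_eq_left (not_lt.1 hle)]; simp
    have h2 : |a - b| / 2 - |s - b| > 0 := by
      by_contra hle; apply hne0; rw [max_eq_left (not_lt.1 hle) (a := (0:ℝ)) (b := |a - b| / 2 - |s - b|)]; simp
    have := abs_sub_le a s b
    rw [abs_sub_comm a s] at this
    linarith
  · rw [hcomm, hcomm']
  · rw [hcomm, hcomm']

theorem g_GH {s : C} (hs : 0 ≤ s) (hs0 : s ≠ 0) :
    ∃ (G H : C) (σ : ℝ), 0 ≤ G ∧ 0 ≤ σ ∧ G ≤ (σ : ℂ) • s ∧ G * G ≤ G ∧ IsSelfAdjoint H ∧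
      (1 - G) * s * H = 0 ∧ s * H ≠ 0 := by
  have hss : IsSelfAdjoint s := .of_nonneg hs
  have hspec : ∀ t ∈ spectrum ℝ s, 0 ≤ t := fun t ht => spectrum_nonneg_of_nonneg hs ht
  have hnt : Nontrivial C := ⟨s, 0, hs0⟩
  have hn : 0 < ‖s‖ := norm_pos_iff.2 hs0
  have hmem : ‖s‖ ∈ spectrum ℝ s := CStarAlgebra.norm_mem_spectrum_of_nonneg hs
  set N := ‖s‖
  let g : ℝ → ℝ := fun t => min 1 (2 * t / N)
  let k : ℝ → ℝ := fun t => max 0 (2 * t / N - 1)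
  have hg : Continuous g := by fun_prop
  have hk : Continuous k := by fun_prop
  have hg0 : ∀ t, 0 ≤ t → 0 ≤ g t := fun t ht => le_min (by norm_num) (by positivity)
  refine ⟨cfc g s, cfc k s, 2 / N, cfc_nonneg fun t ht => hg0 t (hspec t ht), by positivity, ?_, ?_,
    cfc_predicate _ _, ?_, ?_⟩
  · rw [Complex.coe_smul]
    conv_rhs => rw [← cfc_id' ℝ s]
    rw [← cfc_smul _ _ s]
    refine cfc_mono ?_ (by fun_prop) (by fun_prop)
    intro t _
    refine (min_le_right _ _).trans (le_of_eq ?_)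
    simp; ring
  · rw [← cfc_mul _ _ s]
    refine cfc_mono ?_ (by fun_prop) (by fun_prop)
    intro t ht
    have h1 := hg0 t (hspec t ht)
    have h2 : g t ≤ 1 := min_le_left _ _
    nlinarith
  · conv_lhs => enter [1, 2]; rw [← cfc_id' ℝ s]
    rw [← cfc_one (R := ℝ) s, ← cfc_sub _ _ s, ← cfc_mul _ _ s, ← cfc_mul _ _ s, ← cfc_zero ℝ s]
    apply cfc_congr
    intro t _
    simp only [Pi.one_apply, Pi.zero_apply, g, k]
    rcases le_total (2 * t / N) 1 with h | h
    · rw [max_eq_left (by linarith)]; simp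
    · rw [min_eq_left h]; simp
  · intro h0
    have : s * cfc k s = cfc (fun t => t * k t) s := by
      conv_lhs => enter [1]; rw [← cfc_id' ℝ s]
      rw [← cfc_mul _ _ s]
    rw [this] at h0
    have hm : N * k N ∈ spectrum ℝ (cfc (fun t => t * k t) s) := by
      rw [cfc_map_spectrum (fun t => t * k t) s hss (by fun_prop)]
      exact ⟨N, hmem, rfl⟩
    rw [h0, spectrum.zero_eq] at hm
    have : k N = 1 := by
      simp only [k]; rw [mul_div_assoc, div_self hn.ne']; norm_num
    rw [this] at hm
    simp at hm
    exact hn.ne' hm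

theorem g_le_norm {x : C} (hx : IsSelfAdjoint x) {δ : ℝ} (h : ‖x‖ ≤ δ) :
    0 ≤ (δ : ℂ) • 1 - x := by
  rw [sub_nonneg, Complex.coe_smul, ← Algebra.algebraMap_eq_smul_one]
  exact (hx.le_algebraMap_norm_self).trans (algebraMap_mono C h)

theorem g_nonneg_iff {a : C} : 0 ≤ a ↔ ∃ b, a = star b * b :=
  CStarAlgebra.nonneg_iff_eq_star_mul_self

theorem g_sqrt {a : C} (ha : 0 ≤ a) : ∃ t : C, IsSelfAdjoint t ∧ t * t = a :=
  ⟨CFC.sqrt a, .of_nonneg (CFC.sqrt_nonneg a), CFC.sqrt_mul_sqrt_self a ha⟩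

end G


section M
variable {A : Type} [CStarAlgebra A] {ι κ μ : Type} [Fintype ι] [Fintype κ] [Fintype μ]

/-- entrywise `ℓ¹` norm -/
noncomputable def nrm (x : Matrix ι κ A) : ℝ := ∑ i, ∑ j, ‖x i j‖

theorem nrm_nonneg (x : Matrix ι κ A) : 0 ≤ nrm x :=
  Finset.sum_nonneg fun _ _ => Finset.sum_nonneg fun _ _ => norm_nonneg _

theorem entry_le_nrm (x : Matrix ι κ A) (i : ι) (j : κ) : ‖x i j‖ ≤ nrm x :=
  (Finset.single_le_sum (f := fun j => ‖x i j‖) (fun _ _ => norm_nonneg _) (Finset.mem_univ j)).trans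
    (Finset.single_le_sum (f := fun i => ∑ j, ‖x i j‖)
      (fun _ _ => Finset.sum_nonneg fun _ _ => norm_nonneg _) (Finset.mem_univ i))

theorem nrm_add (x y : Matrix ι κ A) : nrm (x + y) ≤ nrm x + nrm y := by
  simp only [nrm, ← Finset.sum_add_distrib]
  gcongr
  exact norm_add_le _ _

theorem nrm_neg (x : Matrix ι κ A) : nrm (-x) = nrm x := by
  simp [nrm]

theorem nrm_sub_comm (x y : Matrix ι κ A) : nrm (x - y) = nrm (y - x) := by
  rw [← nrm_neg, neg_sub]

theorem nrm_sub_le (x y z : Matrix ι κ A) : nrm (x - z) ≤ nrm (x - y) + nrm (y - z) := by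
  have := nrm_add (x - y) (y - z)
  simpa using this

theorem nrm_le_of_entry (x : Matrix ι κ A) {c : ℝ} (h : ∀ i j, ‖x i j‖ ≤ c) :
    nrm x ≤ Fintype.card ι * Fintype.card κ * c := by
  calc nrm x ≤ ∑ _i : ι, ∑ _j : κ, c := by
        unfold nrm; gcongr with i _ j _; exact h i j
    _ = _ := by simp [mul_assoc]

theorem nrm_star (x : Matrix ι κ A) : nrm xᴴ = nrm x := by
  unfold nrm
  rw [Finset.sum_comm]
  simp [Matrix.conjTranspose_apply]

theorem nrm_mul (x : Matrix ι κ A) (y : Matrix κ μ A) : nrm (x * y) ≤ nrm x * nrm y := by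
  unfold nrm
  calc ∑ i, ∑ j, ‖(x * y) i j‖ ≤ ∑ i, ∑ j, ∑ k, ‖x i k‖ * ‖y k j‖ := by
        gcongr with i _ j _
        rw [Matrix.mul_apply]
        exact (norm_sum_le _ _).trans (by gcongr; exact norm_mul_le _ _)
    _ = ∑ i, ∑ k, ‖x i k‖ * ∑ j, ‖y k j‖ := by
        refine Finset.sum_congr rfl fun i _ => ?_
        rw [Finset.sum_comm]
        simp [Finset.mul_sum]
    _ ≤ ∑ i, ∑ k, ‖x i k‖ * ∑ k, ∑ j, ‖y k j‖ := by
        gcongr with i _ k _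
        exact Finset.single_le_sum (f := fun k => ∑ j, ‖y k j‖)
          (fun _ _ => Finset.sum_nonneg fun _ _ => norm_nonneg _) (Finset.mem_univ k)
    _ = _ := by simp [Finset.sum_mul]

theorem matPos_star {a : Matrix ι ι A} (h : MatPos a) : aᴴ = a := by
  obtain ⟨c, rfl⟩ := h
  simp [Matrix.conjTranspose_mul]

/-- the C*-norm is dominated by `nrm` -/
theorem cnorm_le [PartialOrder A] [StarOrderedRing A] (x : Matrix ι κ A) :
    ‖(CStarMatrix.ofMatrix x : CStarMatrix ι κ A)‖ ≤ nrm x := by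
  rw [CStarMatrix.norm_def]
  refine ContinuousLinearMap.opNorm_le_bound _ (nrm_nonneg _) fun v => ?_
  simp only [CStarMatrix.toCLM_apply_eq_sum]
  unfold nrm
  rw [Finset.sum_comm, Finset.sum_mul]
  apply (WithCStarModule.pi_norm_le_sum_norm _).trans
  gcongr with i _
  apply (norm_sum_le _ _).trans
  rw [Finset.sum_mul]
  gcongr with j _
  apply (norm_mul_le _ _).trans
  rw [mul_comm]
  gcongr
  · exact le_rfl
  · exact WithCStarModule.norm_apply_le_norm v j

theorem le_cnorm [PartialOrder A] [StarOrderedRing A] (x : Matrix ι κ A) :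
    nrm x ≤ Fintype.card ι * Fintype.card κ * ‖(CStarMatrix.ofMatrix x : CStarMatrix ι κ A)‖ :=
  nrm_le_of_entry x fun i j => CStarMatrix.norm_entry_le_norm (M := CStarMatrix.ofMatrix x)

theorem matPos_iff [PartialOrder A] [StarOrderedRing A] (a : Matrix ι ι A) :
    MatPos a ↔ (0 : CStarMatrix ι ι A) ≤ CStarMatrix.ofMatrix a := by
  classical
  exact (g_nonneg_iff (C := CStarMatrix ι ι A)).symm

theorem MatPos.add {a b : Matrix ι ι A} (ha : MatPos a) (hb : MatPos b) : MatPos (a + b) := by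
  letI := CStarAlgebra.spectralOrder A
  haveI := CStarAlgebra.spectralOrderedRing A
  rw [matPos_iff] at *
  exact add_nonneg (α := CStarMatrix ι ι A) ha hb

theorem matPos_zero : MatPos (0 : Matrix ι ι A) := ⟨0, by simp⟩

theorem MatPos.sum {τ : Type} (s : Finset τ) {f : τ → Matrix ι ι A} (h : ∀ i, MatPos (f i)) :
    MatPos (∑ i ∈ s, f i) := by
  classical
  induction s using Finset.induction_on with
  | empty => simpa using matPos_zero
  | insert i s hi ih => rw [Finset.sum_insert hi]; exact (h i).add ih

theorem matPos_conjTranspose_mul_self (w : Matrix κ ι A) : MatPos (wᴴ * w) := by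
  classical
  rcases isEmpty_or_nonempty ι with h | ⟨⟨i0⟩⟩
  · exact ⟨0, by ext i; exact h.elim i⟩
  · have : wᴴ * w = ∑ k, (Matrix.of fun (i j : ι) => if i = i0 then w k j else 0)ᴴ *
        (Matrix.of fun (i j : ι) => if i = i0 then w k j else 0) := by
      ext i j
      rw [Matrix.sum_apply, Matrix.mul_apply]
      refine Finset.sum_congr rfl fun k _ => ?_
      rw [Matrix.mul_apply, Finset.sum_eq_single i0]
      · simp [Matrix.conjTranspose_apply]
      · intro b _ hb; simp [hb]
      · simp
    rw [this]
    exact MatPos.sum _ fun k => ⟨_, rfl⟩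

theorem matPos_mul_conjTranspose_self (w : Matrix ι κ A) : MatPos (w * wᴴ) := by
  simpa using matPos_conjTranspose_mul_self wᴴ

theorem MatPos.conj {a : Matrix ι ι A} (ha : MatPos a) (v : Matrix κ ι A) : MatPos (v * a * vᴴ) := by
  obtain ⟨c, rfl⟩ := ha
  have := matPos_conjTranspose_mul_self (c * vᴴ)
  simpa [Matrix.conjTranspose_mul, Matrix.mul_assoc] using this

theorem matPos_one [DecidableEq ι] : MatPos (1 : Matrix ι ι A) := ⟨1, by simp⟩

theorem MatPos.smul {a : Matrix ι ι A} (ha : MatPos a) {r : ℝ} (hr : 0 ≤ r) :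
    MatPos ((r : ℂ) • a) := by
  obtain ⟨c, rfl⟩ := ha
  refine ⟨((Real.sqrt r : ℝ) : ℂ) • c, ?_⟩
  rw [Matrix.conjTranspose_smul, Matrix.smul_mul, Matrix.mul_smul, smul_smul]
  congr 1
  simp only [RCLike.star_def, Complex.conj_ofReal]
  norm_cast
  rw [Real.mul_self_sqrt hr]

theorem m_cuntz {u x : Matrix ι ι A} (hu : MatPos u) (h : MatPos (x - u)) {τ : ℝ} (hτ : 0 < τ) :
    ∃ v : Matrix ι ι A, nrm (v * x * vᴴ - u) < τ := by
  classical
  letI := CStarAlgebra.spectralOrder A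
  haveI := CStarAlgebra.spectralOrderedRing A
  rw [matPos_iff] at *
  obtain ⟨τ', h1, h2⟩ : ∃ τ' : ℝ, 0 < τ' ∧ Fintype.card ι * Fintype.card ι * τ' < τ := by
    refine ⟨τ / (Fintype.card ι * Fintype.card ι + 1), by positivity, ?_⟩
    rw [mul_div_assoc', div_lt_iff₀ (by positivity)]
    nlinarith
  obtain ⟨v, hv⟩ := g_cuntz (C := CStarMatrix ι ι A) hu
    (sub_nonneg (a := CStarMatrix.ofMatrix x).1 h) h1
  refine ⟨CStarMatrix.ofMatrix.symm v, lt_of_le_of_lt (le_cnorm _) (lt_of_le_of_lt ?_ h2)⟩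
  gcongr
  exact hv

theorem m_cut [DecidableEq ι] {x : Matrix ι ι A} (hx : MatPos x) {δ : ℝ} (hδ : 0 < δ) :
    ∃ r : Matrix ι ι A, rᴴ = r ∧ MatPos (r * (x - (δ : ℂ) • (1 : Matrix ι ι A)) * r) ∧
      nrm (x - r * (x - (δ : ℂ) • (1 : Matrix ι ι A)) * r) ≤
        Fintype.card ι * Fintype.card ι * (2 * δ) := by
  letI := CStarAlgebra.spectralOrder A
  haveI := CStarAlgebra.spectralOrderedRing A
  simp only [matPos_iff] at *
  obtain ⟨r, h1, h2, h3⟩ := g_cut (C := CStarMatrix ι ι A) hx hδ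
  refine ⟨CStarMatrix.ofMatrix.symm r, h1, h2, (le_cnorm _).trans ?_⟩
  gcongr
  exact h3

theorem m_bumps {h : Matrix ι ι A} (hh : hᴴ = h) (hn : ¬ ∃ ν : ℝ, h * h = (ν : ℂ) • h) :
    ∃ f g : Matrix ι ι A, fᴴ = f ∧ gᴴ = g ∧ f * g = 0 ∧ f * h = h * f ∧ g * h = h * g ∧
      f * h ≠ 0 ∧ g * h ≠ 0 := by
  classical
  letI := CStarAlgebra.spectralOrder A
  haveI := CStarAlgebra.spectralOrderedRing A
  exact g_bumps (C := CStarMatrix ι ι A) (h := CStarMatrix.ofMatrix h) hh hn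

theorem m_GH [DecidableEq ι] {s : Matrix ι ι A} (hs : MatPos s) (hs0 : s ≠ 0) :
    ∃ (G H : Matrix ι ι A) (σ : ℝ), MatPos G ∧ 0 ≤ σ ∧ MatPos ((σ : ℂ) • s - G) ∧
      MatPos (G - G * G) ∧ Hᴴ = H ∧ (1 - G) * s * H = 0 ∧ s * H ≠ 0 := by
  letI := CStarAlgebra.spectralOrder A
  haveI := CStarAlgebra.spectralOrderedRing A
  simp only [matPos_iff] at *
  obtain ⟨G, H, σ, h1, h2, h3, h4, h5, h6, h7⟩ := g_GH (C := CStarMatrix ι ι A) hs hs0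
  exact ⟨CStarMatrix.ofMatrix.symm G, CStarMatrix.ofMatrix.symm H, σ, h1, h2,
    sub_nonneg (a := (σ : ℂ) • CStarMatrix.ofMatrix s).2 h3,
    sub_nonneg (a := (G : CStarMatrix ι ι A)).2 h4, h5, h6, h7⟩

theorem m_le_nrm [DecidableEq ι] {x : Matrix ι ι A} (hx : xᴴ = x) {δ : ℝ} (h : nrm x ≤ δ) :
    MatPos ((δ : ℂ) • (1 : Matrix ι ι A) - x) := by
  letI := CStarAlgebra.spectralOrder A
  haveI := CStarAlgebra.spectralOrderedRing A
  rw [matPos_iff]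
  exact g_le_norm (C := CStarMatrix ι ι A) (x := CStarMatrix.ofMatrix x) hx ((cnorm_le x).trans h)

theorem m_sqrt {a : Matrix ι ι A} (ha : MatPos a) : ∃ t : Matrix ι ι A, tᴴ = t ∧ t * t = a := by
  classical
  letI := CStarAlgebra.spectralOrder A
  haveI := CStarAlgebra.spectralOrderedRing A
  rw [matPos_iff] at ha
  obtain ⟨t, h1, h2⟩ := g_sqrt (C := CStarMatrix ι ι A) ha
  exact ⟨CStarMatrix.ofMatrix.symm t, h1, h2⟩

theorem diag_zero {u : Matrix κ ι A} {i : ι} (h : (uᴴ * u) i i = 0) (k : κ) : u k i = 0 := by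
  letI := CStarAlgebra.spectralOrder A
  haveI := CStarAlgebra.spectralOrderedRing A
  rw [Matrix.mul_apply] at h
  have := (Finset.sum_eq_zero_iff_of_nonneg (fun k _ => by
    rw [Matrix.conjTranspose_apply]; exact star_mul_self_nonneg _)).1 h k (Finset.mem_univ k)
  rw [Matrix.conjTranspose_apply] at this
  exact (CStarRing.star_mul_self_eq_zero_iff _).1 this

theorem m_zero {u : Matrix κ ι A} (h : uᴴ * u = 0) : u = 0 := by
  ext k i
  exact diag_zero (by rw [h]; rfl) k

theorem m_zero' {u : Matrix κ ι A} (h : u * uᴴ = 0) : u = 0 := by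
  have : uᴴ = 0 := m_zero (by simpa using h)
  simpa using congrArg conjTranspose this

theorem pos_conj_zero {a : Matrix ι ι A} (ha : MatPos a) {v : Matrix κ ι A} (h : v * a * vᴴ = 0) :
    v * a = 0 := by
  obtain ⟨c, rfl⟩ := ha
  have : c * vᴴ = 0 := m_zero (by simpa [Matrix.conjTranspose_mul, Matrix.mul_assoc] using h)
  have h2 : v * cᴴ = 0 := by simpa [Matrix.conjTranspose_mul] using congrArg conjTranspose this
  rw [← Matrix.mul_assoc, h2, Matrix.zero_mul]

end M


section S
variable {A : Type} [CStarAlgebra A] {ι κ μ : Type} [Fintype ι] [Fintype κ] [Fintype μ]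

theorem nrm_zero : nrm (0 : Matrix ι κ A) = 0 := by simp [nrm]

theorem continuous_nrm : Continuous (nrm : Matrix ι κ A → ℝ) := by
  unfold nrm
  refine continuous_finsetSum _ fun i _ => continuous_finsetSum _ fun j _ => ?_
  fun_prop

theorem tendsto_of_nrm {u : ℕ → Matrix ι κ A} {a : Matrix ι κ A}
    (h : Tendsto (fun k => nrm (u k - a)) atTop (𝓝 0)) : Tendsto u atTop (𝓝 a) := by
  refine tendsto_pi_nhds.2 fun i => tendsto_pi_nhds.2 fun j => ?_
  rw [tendsto_iff_norm_sub_tendsto_zero]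
  refine squeeze_zero (fun _ => norm_nonneg _) (fun k => ?_) h
  exact entry_le_nrm (u k - a) i j

theorem mle_iff {a : Matrix ι ι A} {b : Matrix κ κ A} :
    MatCuntzLE a b ↔ ∀ ε > 0, ∃ v : Matrix ι κ A, nrm (v * b * vᴴ - a) < ε := by
  constructor
  · rintro ⟨v, hv⟩ ε hε
    have h1 : Tendsto (fun k => nrm (v k * b * (v k)ᴴ - a)) atTop (𝓝 0) := by
      have := (continuous_nrm (A := A) (ι := ι) (κ := ι)).tendsto (a - a)
      rw [sub_self, nrm_zero] at this
      refine this.comp ?_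
      have := hv.sub_const a
      rwa [sub_self] at this
    obtain ⟨k, hk⟩ := (h1.eventually (gt_mem_nhds hε)).exists
    exact ⟨_, hk⟩
  · intro h
    choose v hv using fun k : ℕ => h (1 / ((k : ℝ) + 1)) Nat.one_div_pos_of_nat
    refine ⟨v, tendsto_of_nrm ?_⟩
    exact squeeze_zero (fun _ => nrm_nonneg _) (fun k => (hv k).le)
      tendsto_one_div_add_atTop_nhds_zero_nat

theorem mle_of_eq {a : Matrix ι ι A} {b : Matrix κ κ A} (v : Matrix ι κ A) (h : a = v * b * vᴴ) :
    MatCuntzLE a b := ⟨fun _ => v, by rw [h]; exact tendsto_const_nhds⟩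

theorem mle_conj (b : Matrix κ κ A) (v : Matrix ι κ A) : MatCuntzLE (v * b * vᴴ) b :=
  mle_of_eq v rfl

theorem mle_refl (a : Matrix ι ι A) : MatCuntzLE a a := by
  classical exact mle_of_eq 1 (by simp)

theorem mle_closed {a : Matrix ι ι A} {b : Matrix κ κ A}
    (h : ∀ ε > 0, ∃ a', nrm (a' - a) < ε ∧ MatCuntzLE a' b) : MatCuntzLE a b := by
  rw [mle_iff]
  intro ε hε
  obtain ⟨a', h1, h2⟩ := h (ε / 2) (by positivity)
  obtain ⟨v, hv⟩ := mle_iff.1 h2 (ε / 2) (by positivity)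
  refine ⟨v, (nrm_sub_le _ a' _).trans_lt ?_⟩
  linarith

theorem mle_trans {a : Matrix ι ι A} {b : Matrix κ κ A} {c : Matrix μ μ A}
    (h1 : MatCuntzLE a b) (h2 : MatCuntzLE b c) : MatCuntzLE a c := by
  refine mle_closed fun ε hε => ?_
  obtain ⟨v, hv⟩ := mle_iff.1 h1 ε hε
  refine ⟨_, hv, mle_iff.2 fun τ hτ => ?_⟩
  obtain ⟨w, hw⟩ := mle_iff.1 h2 (τ / (nrm v * nrm v + 1)) (div_pos hτ (by have := nrm_nonneg v; positivity))
  refine ⟨v * w, ?_⟩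
  have : v * w * c * (v * w)ᴴ - v * b * vᴴ = v * (w * c * wᴴ - b) * vᴴ := by
    simp [Matrix.conjTranspose_mul, Matrix.mul_assoc, Matrix.mul_sub, Matrix.sub_mul]
  rw [this]
  have h0 := nrm_nonneg v
  calc nrm (v * (w * c * wᴴ - b) * vᴴ) ≤ nrm v * nrm (w * c * wᴴ - b) * nrm v := by
        refine (nrm_mul _ _).trans ?_
        rw [nrm_star]
        gcongr
        exact nrm_mul _ _
    _ ≤ nrm v * (τ / (nrm v * nrm v + 1)) * nrm v := by gcongr
    _ = (nrm v * nrm v) * τ / (nrm v * nrm v + 1) := by ring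
    _ < τ := by
        rw [div_lt_iff₀ (by positivity)]
        nlinarith [mul_nonneg h0 h0]

theorem mle_of_le {u x : Matrix ι ι A} (hu : MatPos u) (h : MatPos (x - u)) : MatCuntzLE u x :=
  mle_iff.2 fun _ hτ => m_cuntz hu h hτ

theorem mle_smul (a : Matrix ι ι A) {r : ℝ} (hr : 0 ≤ r) : MatCuntzLE ((r : ℂ) • a) a := by
  classical
  refine mle_of_eq (((Real.sqrt r : ℝ) : ℂ) • (1 : Matrix ι ι A)) ?_
  rw [Matrix.conjTranspose_smul, Matrix.smul_mul, Matrix.mul_smul, Matrix.smul_mul, smul_smul]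
  simp only [RCLike.star_def, Complex.conj_ofReal, Matrix.one_mul, Matrix.conjTranspose_one,
    Matrix.mul_one]
  congr 1
  norm_cast
  rw [Real.mul_self_sqrt hr]

theorem mle_submatrix (a : Matrix ι ι A) (f : κ → ι) : MatCuntzLE (a.submatrix f f) a := by
  classical
  refine mle_of_eq ((1 : Matrix ι ι A).submatrix f id) ?_
  ext i j
  simp [Matrix.mul_apply, Matrix.one_apply]

theorem nrm_fromBlocks (a : Matrix ι ι A) (b : Matrix κ κ A) :
    nrm (fromBlocks a 0 0 b) = nrm a + nrm b := by
  simp [nrm, Fintype.sum_sum_type]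

theorem mle_fromBlocks {ι' κ' : Type} [Fintype ι'] [Fintype κ'] {a : Matrix ι ι A}
    {b : Matrix κ κ A} {a' : Matrix ι' ι' A} {b' : Matrix κ' κ' A}
    (h1 : MatCuntzLE a a') (h2 : MatCuntzLE b b') :
    MatCuntzLE (fromBlocks a 0 0 b) (fromBlocks a' 0 0 b') := by
  refine mle_iff.2 fun ε hε => ?_
  obtain ⟨v, hv⟩ := mle_iff.1 h1 (ε / 2) (by positivity)
  obtain ⟨w, hw⟩ := mle_iff.1 h2 (ε / 2) (by positivity)
  refine ⟨fromBlocks v 0 0 w, ?_⟩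
  have : fromBlocks v 0 0 w * fromBlocks a' 0 0 b' * (fromBlocks v 0 0 w)ᴴ - fromBlocks a 0 0 b
    = fromBlocks (v * a' * vᴴ - a) 0 0 (w * b' * wᴴ - b) := by
    rw [fromBlocks_conjTranspose, fromBlocks_multiply, fromBlocks_multiply, sub_eq_add_neg, fromBlocks_neg, fromBlocks_add]
    simp [sub_eq_add_neg]
  rw [this, nrm_fromBlocks]
  linarith

theorem mle_add_blocks (a b : Matrix ι ι A) : MatCuntzLE (a + b) (fromBlocks a 0 0 b) := by
  classical
  refine mle_of_eq (fromCols (1 : Matrix ι ι A) (1 : Matrix ι ι A)) ?_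
  rw [conjTranspose_fromCols_eq_fromRows_conjTranspose, fromCols_mul_fromBlocks,
    fromCols_mul_fromRows]
  simp

theorem blocks_mle {a : Matrix ι ι A} (v : Matrix κ ι A) (w : Matrix μ ι A)
    (h : v * a * wᴴ = 0) (hh : w * a * vᴴ = 0) :
    MatCuntzLE (fromBlocks (v * a * vᴴ) 0 0 (w * a * wᴴ)) a := by
  refine mle_of_eq (fromRows v w) ?_
  rw [conjTranspose_fromRows_eq_fromCols_conjTranspose, fromRows_mul, fromRows_mul_fromCols, h, hh]

/-- objects -/
structure CObj (A : Type) where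
  n : ℕ
  m : Matrix (Fin n) (Fin n) A

instance : Preorder (CObj A) where
  le a b := MatCuntzLE a.m b.m
  le_refl a := mle_refl a.m
  le_trans _ _ _ h1 h2 := mle_trans h1 h2

/-- the object of a matrix over any finite index type -/
noncomputable def mkObj (a : Matrix ι ι A) : CObj A :=
  ⟨Fintype.card ι, a.submatrix (Fintype.equivFin ι).symm (Fintype.equivFin ι).symm⟩

theorem mkObj_le {a : Matrix ι ι A} {b : Matrix κ κ A} :
    mkObj a ≤ mkObj b ↔ MatCuntzLE a b := by
  have h1 : ∀ {ι : Type} [Fintype ι] (a : Matrix ι ι A), MatCuntzLE (mkObj a).m a :=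
    fun a => mle_submatrix _ _
  have h2 : ∀ {ι : Type} [Fintype ι] (a : Matrix ι ι A), MatCuntzLE a (mkObj a).m := by
    intro ι _ a
    have := mle_submatrix (mkObj a).m (Fintype.equivFin ι)
    simpa [mkObj] using this
  exact ⟨fun h => mle_trans (h2 a) (mle_trans h (h1 b)),
    fun h => mle_trans (h1 a) (mle_trans h (h2 b))⟩

/-- the semigroup -/
def CW (A : Type) [CStarAlgebra A] := Antisymmetrization (CObj A) (· ≤ ·)

noncomputable instance : PartialOrder (CW A) :=
  inferInstanceAs (PartialOrder (Antisymmetrization (CObj A) (· ≤ ·)))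

/-- class of a matrix -/
noncomputable def cls (a : Matrix ι ι A) : CW A := toAntisymmetrization (· ≤ ·) (mkObj a)

theorem cls_le {a : Matrix ι ι A} {b : Matrix κ κ A} : cls a ≤ cls b ↔ MatCuntzLE a b :=
  mkObj_le

theorem cls_surj (x : CW A) : ∃ (n : ℕ) (a : Matrix (Fin n) (Fin n) A), x = cls a := by
  obtain ⟨x, rfl⟩ := Quotient.exists_rep x
  refine ⟨x.n, x.m, ?_⟩
  apply Quotient.sound
  refine ⟨?_, ?_⟩
  · have := mle_submatrix (mkObj x.m).m (Fintype.equivFin (Fin x.n))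
    simp only [mkObj, Matrix.submatrix_submatrix, Equiv.symm_comp_self,
      Matrix.submatrix_id_id] at this
    exact this
  · exact mle_submatrix x.m _

theorem cls_submatrix (a : Matrix ι ι A) (e : κ ≃ ι) : cls (a.submatrix e e) = cls a := by
  apply le_antisymm
  · exact cls_le.2 (mle_submatrix _ _)
  · rw [cls_le]
    have := mle_submatrix (a.submatrix e e) e.symm
    simpa using this

theorem obj_add_mono {a b c d : CObj A} (h1 : a ≤ c) (h2 : b ≤ d) :
    mkObj (fromBlocks a.m 0 0 b.m) ≤ mkObj (fromBlocks c.m 0 0 d.m) :=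
  mkObj_le.2 (mle_fromBlocks h1 h2)

noncomputable instance : Add (CW A) where
  add := Quotient.map₂ (fun a b => mkObj (fromBlocks a.m 0 0 b.m))
    (fun _ _ h _ _ h' => ⟨obj_add_mono h.1 h'.1, obj_add_mono h.2 h'.2⟩)

theorem cls_blocks (a : Matrix ι ι A) (b : Matrix κ κ A) :
    cls (fromBlocks a 0 0 b) = cls a + cls b := by
  have hh : cls a + cls b = cls (fromBlocks (mkObj a).m 0 0 (mkObj b).m) := rfl
  rw [hh, ← cls_submatrix (fromBlocks a 0 0 b)
    (Equiv.sumCongr (Fintype.equivFin ι).symm (Fintype.equivFin κ).symm)]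
  congr 1
  ext i j
  rcases i with i | i <;> rcases j with j | j <;> simp [mkObj] <;> rfl

theorem cls_eq_of_equiv {a : Matrix ι ι A} {b : Matrix κ κ A} (e : κ ≃ ι)
    (h : a.submatrix e e = b) : cls a = cls b := by
  rw [← h, cls_submatrix]

noncomputable instance : Zero (CW A) := ⟨cls (0 : Matrix Empty Empty A)⟩

noncomputable instance : AddCommMonoid (CW A) where
  add_assoc x y z := by
    obtain ⟨n, a, rfl⟩ := cls_surj x
    obtain ⟨m, b, rfl⟩ := cls_surj y
    obtain ⟨l, c, rfl⟩ := cls_surj z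
    simp only [← cls_blocks]
    refine cls_eq_of_equiv (Equiv.sumAssoc _ _ _).symm ?_
    ext i j
    rcases i with i | i | i <;> rcases j with j | j | j <;> simp
  zero_add x := by
    obtain ⟨n, a, rfl⟩ := cls_surj x
    have : (0 : CW A) = cls (0 : Matrix Empty Empty A) := rfl
    rw [this, ← cls_blocks]
    refine cls_eq_of_equiv (Equiv.emptySum _ _).symm ?_
    ext i j
    simp
  add_zero x := by
    obtain ⟨n, a, rfl⟩ := cls_surj x
    have : (0 : CW A) = cls (0 : Matrix Empty Empty A) := rfl
    rw [this, ← cls_blocks]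
    refine cls_eq_of_equiv (Equiv.sumEmpty _ _).symm ?_
    ext i j
    simp
  add_comm x y := by
    obtain ⟨n, a, rfl⟩ := cls_surj x
    obtain ⟨m, b, rfl⟩ := cls_surj y
    simp only [← cls_blocks]
    refine cls_eq_of_equiv (Equiv.sumComm _ _) ?_
    ext i j
    rcases i with i | i <;> rcases j with j | j <;> simp
  nsmul := nsmulRec

instance : IsOrderedAddMonoid (CW A) where
  add_le_add_left x y h z := by
    obtain ⟨n, a, rfl⟩ := cls_surj x
    obtain ⟨m, b, rfl⟩ := cls_surj y
    obtain ⟨l, c, rfl⟩ := cls_surj z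
    rw [← cls_blocks, ← cls_blocks, cls_le]
    exact mle_fromBlocks (cls_le.1 h) (mle_refl _)

theorem cls_nonneg (x : CW A) : 0 ≤ x := by
  obtain ⟨n, a, rfl⟩ := cls_surj x
  have : (0 : CW A) = cls (0 : Matrix Empty Empty A) := rfl
  rw [this, cls_le]
  exact mle_of_eq 0 (by ext i; exact i.elim)

theorem cls_zero : cls (0 : Matrix ι ι A) = 0 := by
  apply le_antisymm _ (cls_nonneg _)
  have : (0 : CW A) = cls (0 : Matrix Empty Empty A) := rfl
  rw [this, cls_le]
  exact mle_of_eq 0 (by simp)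

theorem cls_matRep (k : ℕ) (a : Matrix ι ι A) : cls (matRep k a) = k • cls a := by
  induction k with
  | zero =>
    rw [zero_smul]
    have : matRep 0 a = 0 := by ext ⟨i, j⟩; exact j.elim0
    rw [this, cls_zero]
  | succ k ih =>
    rw [succ_nsmul, ← ih, ← cls_blocks]
    let e : (ι × Fin k) ⊕ ι ≃ ι × Fin (k + 1) :=
      ((Equiv.sumCongr (Equiv.refl (ι × Fin k)) (Equiv.prodUnique ι (Fin 1)).symm).trans
        (Equiv.prodSumDistrib ι (Fin k) (Fin 1)).symm).trans
        (Equiv.prodCongr (Equiv.refl ι) finSumFinEquiv)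
    have e1 : ∀ p : ι × Fin k, e (Sum.inl p) = (p.1, Fin.castAdd 1 p.2) := fun p => by
      simp [e, Equiv.prodSumDistrib]
    have e2 : ∀ p : ι, e (Sum.inr p) = (p, Fin.natAdd k 0) := fun p => by
      simp [e, Equiv.prodSumDistrib]
    refine cls_eq_of_equiv e ?_
    ext i j
    rcases i with ⟨i, i'⟩ | i <;> rcases j with ⟨j, j'⟩ | j <;>
      simp [e1, e2, matRep, Matrix.blockDiagonal_apply, Fin.ext_iff]
    · intro h; have := i'.2; omega
    · intro h; have hj := j'.2; omega

def one1 (p : A) : Matrix Unit Unit A := Matrix.of fun _ _ => p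

theorem cls_diag (n : ℕ) (p : A) :
    cls (Matrix.diagonal fun _ : Fin n => p) = n • cls (one1 p) := by
  rw [← cls_matRep]
  refine cls_eq_of_equiv (Equiv.punitProd (Fin n)) ?_
  ext i j
  simp [matRep, Matrix.blockDiagonal_apply, one1, Matrix.diagonal_apply]

theorem cls_add_le (a b : Matrix ι ι A) : cls (a + b) ≤ cls a + cls b := by
  rw [← cls_blocks, cls_le]; exact mle_add_blocks a b

theorem cls_sum_le {τ : Type} (s : Finset τ) (f : τ → Matrix ι ι A) :
    cls (∑ i ∈ s, f i) ≤ ∑ i ∈ s, cls (f i) := by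
  classical
  induction s using Finset.induction_on with
  | empty => simp [cls_zero]
  | insert i s hi ih =>
    rw [Finset.sum_insert hi, Finset.sum_insert hi]
    exact (cls_add_le _ _).trans (add_le_add le_rfl ih)

theorem cuntzLE_cls {a b : A} (h : CuntzLE a b) : cls (one1 a) ≤ cls (one1 b) := by
  rw [cls_le]
  obtain ⟨v, hv⟩ := h
  refine ⟨fun k => one1 (v k), ?_⟩
  refine tendsto_pi_nhds.2 fun i => tendsto_pi_nhds.2 fun j => ?_
  refine hv.congr fun k => ?_
  simp [one1, Matrix.mul_apply]

end S


section T
variable {A : Type} [CStarAlgebra A] {ι κ μ ν : Type} [Fintype ι] [Fintype κ] [Fintype μ] [Fintype ν]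

theorem simple_unit (hs : IsSimpleCStarAlgebra A) {d : A} (hd : d ≠ 0) :
    ∃ (L : ℕ) (x y : Fin L → A), ∑ l, x l * d * y l = 1 := by
  let J : AddSubgroup A := AddSubgroup.closure {z | ∃ x y, z = x * d * y}
  have hl : ∀ c z, z ∈ J → c * z ∈ J := by
    intro c z hz
    induction hz using AddSubgroup.closure_induction with
    | mem z hz =>
      obtain ⟨x, y, rfl⟩ := hz
      exact AddSubgroup.subset_closure ⟨c * x, y, by noncomm_ring⟩
    | zero => rw [mul_zero]; exact J.zero_mem
    | add x y _ _ h1 h2 => rw [mul_add]; exact J.add_mem h1 h2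
    | neg x _ h => rw [mul_neg]; exact J.neg_mem h
  have hr : ∀ c z, z ∈ J → z * c ∈ J := by
    intro c z hz
    induction hz using AddSubgroup.closure_induction with
    | mem z hz =>
      obtain ⟨x, y, rfl⟩ := hz
      exact AddSubgroup.subset_closure ⟨x, y * c, by noncomm_ring⟩
    | zero => rw [zero_mul]; exact J.zero_mem
    | add x y _ _ h1 h2 => rw [add_mul]; exact J.add_mem h1 h2
    | neg x _ h => rw [neg_mul]; exact J.neg_mem h
  let K : AddSubgroup A := J.topologicalClosure
  have hl' : ∀ {c z : A}, z ∈ K → c * z ∈ K := fun {c z} hz =>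
    map_mem_closure (f := fun z => c * z) (by fun_prop) hz (fun z hz => hl c z hz)
  have hr' : ∀ {z c : A}, z ∈ K → z * c ∈ K := fun {z c} hz =>
    map_mem_closure (f := fun z => z * c) (by fun_prop) hz (fun z hz => hr c z hz)
  let I : TwoSidedIdeal A := TwoSidedIdeal.mk' (K : Set A) K.zero_mem
    (fun h1 h2 => K.add_mem h1 h2) (fun h => K.neg_mem h) hl' hr'
  have hI : (I : Set A) = K := TwoSidedIdeal.coe_mk' _ _ _ _ _ _
  have hmem : ∀ z, z ∈ I ↔ z ∈ K := fun z => by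
    rw [← SetLike.mem_coe, hI]; rfl
  have hdJ : d ∈ J := AddSubgroup.subset_closure ⟨1, 1, by simp⟩
  have h1 : (1 : A) ∈ K := by
    rcases hs I (by rw [hI]; exact J.isClosed_topologicalClosure) with h | h
    · exfalso
      apply hd
      have : d ∈ I := (hmem d).2 (J.le_topologicalClosure hdJ)
      rw [h] at this
      exact (TwoSidedIdeal.mem_bot A).1 this
    · rw [← hmem, h]; trivial
  have h2 : (1 : A) ∈ J := by
    obtain ⟨z, hz, hz'⟩ := Metric.mem_closure_iff.1 h1 1 one_pos
    rw [dist_eq_norm] at hz'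
    have hu : IsUnit z := by
      have := (Units.oneSub (1 - z) hz').isUnit
      simpa using this
    obtain ⟨u, rfl⟩ := hu
    have := hl (↑u⁻¹) _ hz
    simpa using this
  have hneg : ∀ l : List (A × A), ((l.map fun p => (-p.1, p.2)).map fun p => p.1 * d * p.2).sum =
      -(l.map fun p => p.1 * d * p.2).sum := by
    intro l
    induction l with
    | nil => simp
    | cons p l ih =>
      rw [List.map_cons, List.map_cons, List.sum_cons, List.map_cons, List.sum_cons, ih, neg_add]
      simp
  have h3 : ∀ z ∈ J, ∃ l : List (A × A), (l.map fun p => p.1 * d * p.2).sum = z := by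
    intro z hz
    induction hz using AddSubgroup.closure_induction with
    | mem z hz =>
      obtain ⟨x, y, rfl⟩ := hz
      exact ⟨[(x, y)], by simp⟩
    | zero => exact ⟨[], rfl⟩
    | add x y _ _ h1 h2 =>
      obtain ⟨l, rfl⟩ := h1
      obtain ⟨l', rfl⟩ := h2
      exact ⟨l ++ l', by simp⟩
    | neg x _ h =>
      obtain ⟨l, rfl⟩ := h
      exact ⟨l.map fun p => (-p.1, p.2), hneg l⟩
  obtain ⟨l, hl⟩ := h3 1 h2
  refine ⟨l.length, fun i => (l.get i).1, fun i => (l.get i).2, ?_⟩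
  rw [← hl, ← List.sum_ofFn]
  congr 1
  conv_rhs => rw [← List.ofFn_get l]
  rw [List.map_ofFn]
  rfl

theorem prod_ne_zero (hs : IsSimpleCStarAlgebra A) {u : Matrix ι κ A} {w : Matrix μ ν A}
    (hu : u ≠ 0) (hw : w ≠ 0) : ∃ Z : Matrix κ μ A, u * Z * w ≠ 0 := by
  classical
  by_contra! hc
  obtain ⟨i, j, hij⟩ : ∃ i j, u i j ≠ 0 := by
    by_contra! h; exact hu (by ext i j; exact h i j)
  obtain ⟨k, l, hkl⟩ : ∃ i j, w i j ≠ 0 := by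
    by_contra! h; exact hw (by ext i j; exact h i j)
  have h : ∀ x, u i j * x * w k l = 0 := by
    intro x
    have := congrFun (congrFun (hc (Matrix.single j k x)) i) l
    rw [Matrix.mul_apply, Finset.sum_eq_single k] at this
    · simpa using this
    · intro b _ hb
      simp [Matrix.mul_single_apply_of_ne _ _ _ _ _ hb]
    · simp
  obtain ⟨L, x, y, hxy⟩ := simple_unit hs hij
  apply hkl
  rw [← one_mul (w k l), ← hxy, Finset.sum_mul]
  refine Finset.sum_eq_zero fun t _ => ?_
  have := h (y t)
  rw [mul_assoc, mul_assoc, ← mul_assoc (u i j), this, mul_zero]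

theorem exists_diag {b : Matrix ι ι A} (hb : MatPos b) (h0 : b ≠ 0) : ∃ i, b i i ≠ 0 := by
  by_contra! h
  obtain ⟨c, rfl⟩ := hb
  apply h0
  have : c = 0 := by ext k i; exact diag_zero (h i) k
  simp [this]

theorem matPos_submatrix {b : Matrix ι ι A} (hb : MatPos b) (f : κ → ι) :
    MatPos (b.submatrix f f) := by
  classical
  have := hb.conj ((1 : Matrix ι ι A).submatrix f id)
  convert this
  ext i j
  simp [Matrix.mul_apply, Matrix.one_apply]

theorem exists_elem {b : Matrix ι ι A} (hb : MatPos b) (h0 : b ≠ 0) :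
    ∃ d : A, d ≠ 0 ∧ MatPos (one1 d) ∧ cls (one1 d) ≤ cls b := by
  obtain ⟨i, hi⟩ := exists_diag hb h0
  exact ⟨b i i, hi, matPos_submatrix hb fun _ => i, cls_le.2 (mle_submatrix b fun _ => i)⟩

theorem absorb (hs : IsSimpleCStarAlgebra A) {n : ℕ} {a : Matrix (Fin n) (Fin n) A}
    (ha : MatPos a) {b : Matrix ι ι A} (hb : MatPos b) (h0 : b ≠ 0) :
    ∃ L : ℕ, cls a ≤ L • cls b := by
  obtain ⟨d, hd, hD, hdb⟩ := exists_elem hb h0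
  obtain ⟨L, x, y, hxy⟩ := simple_unit hs hd
  let S : Matrix Unit Unit A := ∑ l, (one1 (x l) * one1 d * (one1 (x l))ᴴ +
    (one1 (y l))ᴴ * one1 d * (one1 (y l))ᴴᴴ)
  have hsum : ∑ l, one1 (x l) * one1 d * one1 (y l) = (1 : Matrix Unit Unit A) := by
    ext i j
    rw [Matrix.sum_apply, Matrix.one_apply, if_pos rfl, ← hxy]
    refine Finset.sum_congr rfl fun l _ => ?_
    simp [one1, Matrix.mul_apply]
  have hsum' : ∑ l, (one1 (y l))ᴴ * one1 d * (one1 (x l))ᴴ = (1 : Matrix Unit Unit A) := by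
    have := congrArg conjTranspose hsum
    rw [Matrix.conjTranspose_sum, conjTranspose_one] at this
    rw [← this]
    refine Finset.sum_congr rfl fun l _ => ?_
    rw [conjTranspose_mul, conjTranspose_mul, matPos_star hD, Matrix.mul_assoc]
  have hS : MatPos (S - 1) := by
    have h1 : S - 1 = ∑ l, (one1 (x l) - (one1 (y l))ᴴ) * one1 d *
        (one1 (x l) - (one1 (y l))ᴴ)ᴴ + 1 := by
      have : ∑ l, (one1 (x l) - (one1 (y l))ᴴ) * one1 d * (one1 (x l) - (one1 (y l))ᴴ)ᴴ
          = S - ∑ l, one1 (x l) * one1 d * one1 (y l) -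
            ∑ l, (one1 (y l))ᴴ * one1 d * (one1 (x l))ᴴ := by
        simp only [S]
        rw [← Finset.sum_sub_distrib, ← Finset.sum_sub_distrib]
        refine Finset.sum_congr rfl fun l _ => ?_
        simp only [conjTranspose_sub, conjTranspose_conjTranspose]
        noncomm_ring
      rw [this, hsum, hsum']
      abel
    rw [h1]
    exact (MatPos.sum _ fun l => hD.conj _).add matPos_one
  have h2 : cls (1 : Matrix Unit Unit A) ≤ (L * 2) • cls b := by
    refine (cls_le.2 (mle_of_le matPos_one hS)).trans ((cls_sum_le _ _).trans ?_)
    rw [mul_smul]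
    refine (Finset.sum_le_card_nsmul _ _ (2 • cls b) fun l _ => ?_).trans (by simp)
    refine (cls_add_le _ _).trans ?_
    rw [two_nsmul]
    exact add_le_add ((cls_le.2 (mle_conj _ _)).trans hdb) ((cls_le.2 (mle_conj _ _)).trans hdb)
  refine ⟨n * (L * 2), ?_⟩
  have h3 : cls (1 : Matrix (Fin n) (Fin n) A) = n • cls (1 : Matrix Unit Unit A) := by
    have := cls_diag n (1 : A)
    rw [Matrix.diagonal_one] at this
    rw [this]; congr 2
  have h4 : cls a ≤ cls (1 : Matrix (Fin n) (Fin n) A) := by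
    obtain ⟨c, rfl⟩ := ha
    rw [cls_le]
    exact mle_of_eq cᴴ (by simp)
  rw [h3] at h4
  rw [mul_smul]
  exact h4.trans (nsmul_le_nsmul_right h2 n)

end T


section U
variable {A : Type} [CStarAlgebra A] {ι κ μ ν : Type} [Fintype ι] [Fintype κ] [Fintype μ] [Fintype ν]

/-- non-elementary -/
def NonElem (A : Type) [CStarAlgebra A] : Prop :=
  ∀ (n : ℕ) (d : Matrix (Fin n) (Fin n) A), MatPos d → d ≠ 0 →
    ∃ X : Matrix (Fin n) (Fin n) A, Xᴴ = X ∧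
      ¬ ∃ ν : ℝ, (d * X * d) * (d * X * d) = (ν : ℂ) • (d * X * d)

theorem matPos_antisymm {x : Matrix ι ι A} (h : MatPos x) (h' : MatPos (-x)) : x = 0 := by
  let _ := CStarAlgebra.spectralOrder A
  have := CStarAlgebra.spectralOrderedRing A
  rw [matPos_iff] at h h'
  have h2 : CStarMatrix.ofMatrix x ≤ 0 := neg_nonneg (α := CStarMatrix ι ι A).1 h'
  exact le_antisymm (α := CStarMatrix ι ι A) h2 h

theorem blocks_cls {a : Matrix ι ι A} (ha : aᴴ = a) (v : Matrix κ ι A) (w : Matrix μ ι A)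
    (h : v * a * wᴴ = 0) : cls (v * a * vᴴ) + cls (w * a * wᴴ) ≤ cls a := by
  rw [← cls_blocks, cls_le]
  refine blocks_mle v w h ?_
  have := congrArg conjTranspose h
  simpa [conjTranspose_mul, ha, Matrix.mul_assoc] using this

theorem halve (hs : IsSimpleCStarAlgebra A) (hN : NonElem A) {n : ℕ}
    {d : Matrix (Fin n) (Fin n) A} (hd : MatPos d) (h0 : d ≠ 0) :
    ∃ d' : Matrix (Fin n) (Fin n) A, MatPos d' ∧ d' ≠ 0 ∧ 2 • cls d' ≤ cls d := by
  obtain ⟨X, hX, hX'⟩ := hN n d hd h0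
  have hds := matPos_star hd
  obtain ⟨f, g, hf, hg, hfg, hfh, hgh, hf0, hg0⟩ := m_bumps (h := d * X * d)
    (by simp [conjTranspose_mul, hX, hds, Matrix.mul_assoc]) hX'
  obtain ⟨t, ht, htt⟩ := m_sqrt hd
  have hp : (f * t)ᴴ ≠ 0 := by
    intro h
    apply hf0
    have h1 : f * t = 0 := by simpa using congrArg conjTranspose h
    have : f * (d * X * d) = (f * t) * (t * X * d) := by rw [← htt]; noncomm_ring
    rw [this, h1, Matrix.zero_mul]
  have hr : g * d * X * t ≠ 0 := by
    intro h
    apply hg0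
    have : g * (d * X * d) = (g * d * X * t) * t := by
      rw [Matrix.mul_assoc _ t t, htt]; noncomm_ring
    rw [this, h, Matrix.zero_mul]
  obtain ⟨Z, hZ⟩ := prod_ne_zero hs hp hr
  set p := f * t with hpdef
  set r := g * d * X * t with hrdef
  set y := pᴴ * Z * r with hy
  have hsp : MatPos (y * yᴴ) := matPos_mul_conjTranspose_self y
  obtain ⟨q, hq, hqq⟩ := m_sqrt hsp
  refine ⟨(y * yᴴ) * (y * yᴴ), ?_, ?_, ?_⟩
  · have := matPos_mul_conjTranspose_self (y * yᴴ)
    rwa [matPos_star hsp] at this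
  · intro h
    apply hZ
    apply m_zero'
    apply m_zero'
    rw [matPos_star hsp, h]
  · have e1 : (y * yᴴ) * (y * yᴴ) = q * (y * yᴴ) * qᴴ := by
      rw [hq, ← hqq]; noncomm_ring
    have e2 : (y * yᴴ) * (y * yᴴ) = y * (yᴴ * y) * yᴴ := by noncomm_ring
    have e3 : y * yᴴ = (pᴴ * Z) * (r * rᴴ) * (pᴴ * Z)ᴴ := by
      rw [hy]; simp only [conjTranspose_mul, conjTranspose_conjTranspose, Matrix.mul_assoc]
    have e4 : yᴴ * y = (rᴴ * Zᴴ) * (p * pᴴ) * (rᴴ * Zᴴ)ᴴ := by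
      rw [hy]; simp only [conjTranspose_mul, conjTranspose_conjTranspose, Matrix.mul_assoc]
    have e5 : p * pᴴ = f * d * fᴴ := by
      rw [hpdef, conjTranspose_mul, ht, ← htt]; simp only [Matrix.mul_assoc]
    have e6 : r * rᴴ = (g * d * X) * d * (g * d * X)ᴴ := by
      rw [hrdef, conjTranspose_mul (g * d * X) t, ht, Matrix.mul_assoc _ t, ← Matrix.mul_assoc t t,
        htt, ← Matrix.mul_assoc]
    rw [two_nsmul]
    have i1 : cls (y * yᴴ * (y * yᴴ)) ≤ cls (f * d * fᴴ) := by
      rw [e2, ← e5]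
      refine (cls_le.2 (mle_conj _ _)).trans ?_
      rw [e4]
      exact cls_le.2 (mle_conj _ _)
    have i2 : cls (y * yᴴ * (y * yᴴ)) ≤ cls ((g * d * X) * d * (g * d * X)ᴴ) := by
      rw [e1, ← e6]
      refine (cls_le.2 (mle_conj _ _)).trans ?_
      rw [e3]
      exact cls_le.2 (mle_conj _ _)
    refine (add_le_add i1 i2).trans (blocks_cls hds _ _ ?_)
    have : f * d * (g * d * X)ᴴ = f * (d * X * d) * g := by
      simp only [conjTranspose_mul, hds, hX, hg, Matrix.mul_assoc]
    rw [this, hfh, Matrix.mul_assoc, hfg, Matrix.mul_zero]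

theorem divide (hs : IsSimpleCStarAlgebra A) (hN : NonElem A) (K : ℕ) {n : ℕ}
    {d : Matrix (Fin n) (Fin n) A} (hd : MatPos d) (h0 : d ≠ 0) :
    ∃ d' : Matrix (Fin n) (Fin n) A, MatPos d' ∧ d' ≠ 0 ∧ K • cls d' ≤ cls d := by
  have : ∀ N : ℕ, ∃ d' : Matrix (Fin n) (Fin n) A, MatPos d' ∧ d' ≠ 0 ∧
      (2 ^ N) • cls d' ≤ cls d := by
    intro N
    induction N with
    | zero => exact ⟨d, hd, h0, by simp⟩
    | succ N ih =>
      obtain ⟨d1, h1, h2, h3⟩ := ih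
      obtain ⟨d2, h4, h5, h6⟩ := halve hs hN h1 h2
      refine ⟨d2, h4, h5, ?_⟩
      rw [pow_succ, mul_smul]
      exact (nsmul_le_nsmul_right h6 _).trans h3
  obtain ⟨d', h1, h2, h3⟩ := this K
  exact ⟨d', h1, h2, (nsmul_le_nsmul_left (cls_nonneg _) Nat.lt_two_pow_self.le).trans h3⟩

theorem split (hs : IsSimpleCStarAlgebra A) (hN : NonElem A) {n m : ℕ}
    {b : Matrix (Fin m) (Fin m) A} (hb : MatPos b) (hb0 : b ≠ 0)
    {c : Matrix (Fin n) (Fin n) A} (hc : MatPos c) (hc0 : c ≠ 0) :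
    ∃ b1 b0 : Matrix (Fin m) (Fin m) A, MatPos b1 ∧ b1 ≠ 0 ∧ MatPos b0 ∧ b0 ≠ 0 ∧
      cls b1 + cls b0 ≤ cls b ∧ cls b ≤ cls b1 + cls c := by
  obtain ⟨X, hX, hX'⟩ := hN m b hb hb0
  have hbs := matPos_star hb
  obtain ⟨f, g, hf, hg, hfg, hfh, hgh, hf0, hg0⟩ := m_bumps (h := b * X * b)
    (by simp [conjTranspose_mul, hX, hbs, Matrix.mul_assoc]) hX'
  have hgf : g * f = 0 := by
    have := congrArg conjTranspose hfg
    simpa [conjTranspose_mul, hf, hg] using this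
  obtain ⟨t, ht, htt⟩ := m_sqrt hc
  have ht0 : t ≠ 0 := by rintro rfl; exact hc0 (by rw [← htt]; simp)
  obtain ⟨Z, hZ⟩ := prod_ne_zero hs ht0 hg0
  set h := b * X * b with hh
  have hhs : hᴴ = h := by simp [hh, conjTranspose_mul, hX, hbs, Matrix.mul_assoc]
  set Y := X * b * g * Zᴴ * c * Z * g * b * X with hY
  have hcs := matPos_star hc
  have hYs : Yᴴ = Y := by
    simp only [hY, conjTranspose_mul, hX, hbs, hg, hcs, conjTranspose_conjTranspose,
      Matrix.mul_assoc]
  set s := b * Y * b with hsdef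
  have hs1 : s = (t * Z * (g * h))ᴴ * (t * Z * (g * h)) := by
    simp only [hsdef, hY, hh, conjTranspose_mul, hX, hbs, hg, ht, ← htt,
      Matrix.mul_assoc]
  have hs2 : s = (h * g * Zᴴ) * c * (h * g * Zᴴ)ᴴ := by
    simp only [hsdef, hY, hh, conjTranspose_mul, hX, hbs, hg, conjTranspose_conjTranspose,
      Matrix.mul_assoc]
  have hspos : MatPos s := by rw [hs1]; exact matPos_conjTranspose_mul_self _
  have hss := matPos_star hspos
  have hsne : s ≠ 0 := by
    intro h0
    exact hZ (m_zero (by rw [← hs1, h0]))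
  have hsf : s * f = 0 := by
    have : s * f = h * g * Zᴴ * c * Z * (g * (h * f)) := by
      rw [hs2]; simp only [conjTranspose_mul, conjTranspose_conjTranspose, hg, hhs,
        Matrix.mul_assoc]
    rw [this, ← hfh, ← Matrix.mul_assoc g, hgf, Matrix.zero_mul, Matrix.mul_zero]
  obtain ⟨G, H, σ, hG, hσ, hGσ, hGG, hH, hGsH, hsH⟩ := m_GH hspos hsne
  have hGs := matPos_star hG
  have h1G : (1 - G)ᴴ = 1 - G := by rw [conjTranspose_sub, conjTranspose_one, hGs]
  refine ⟨(1 - G) * b * (1 - G)ᴴ, (H * b * Y) * b * (H * b * Y)ᴴ, hb.conj _, ?_, hb.conj _, ?_,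
    ?_, ?_⟩
  · intro h0
    have h1 := pos_conj_zero hb h0
    have hfGf : f * G * fᴴ = 0 := by
      apply matPos_antisymm (hG.conj f)
      have := hGσ.conj f
      have e : f * ((σ : ℂ) • s - G) * fᴴ = - (f * G * fᴴ) := by
        rw [hf, Matrix.mul_sub, Matrix.sub_mul, Matrix.mul_smul, Matrix.smul_mul, Matrix.mul_assoc,
          hsf]
        simp
      rwa [e] at this
    have hfG := pos_conj_zero hG hfGf
    have hGf : G * f = 0 := by
      have := congrArg conjTranspose hfG
      simpa [conjTranspose_mul, hf, hGs] using this
    apply hf0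
    have h2 : b = G * b := by
      rw [Matrix.sub_mul, Matrix.one_mul] at h1
      exact sub_eq_zero.1 h1
    have h3 : h = G * h := by
      have : G * h = (G * b) * X * b := by rw [hh]; simp only [Matrix.mul_assoc]
      rw [this, ← h2]
    rw [hfh]
    conv_lhs => rw [h3]
    rw [Matrix.mul_assoc, ← hfh, ← Matrix.mul_assoc, hGf, Matrix.zero_mul]
  · intro h0
    have h1 := pos_conj_zero hb h0
    apply hsH
    have h2 : H * s = 0 := by rw [← h1, hsdef]; simp only [Matrix.mul_assoc]
    have := congrArg conjTranspose h2
    simpa [conjTranspose_mul, hH, hss] using this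
  · refine blocks_cls hbs _ _ ?_
    rw [← hGsH, hsdef]
    simp only [conjTranspose_mul, hbs, hYs, hH, Matrix.mul_assoc]
  · have e1 : ((2 : ℝ) : ℂ) • ((1 - G) * b * (1 - G)ᴴ + G * b * Gᴴ) - b =
        (1 - 2 * G) * b * (1 - 2 * G)ᴴ := by
      have : (1 - 2 * G)ᴴ = 1 - 2 * G := by
        rw [two_mul, conjTranspose_sub, conjTranspose_add, conjTranspose_one, hGs]
      rw [this, h1G, hGs]
      have h2 : ∀ z : Matrix (Fin m) (Fin m) A, ((2 : ℝ) : ℂ) • z = z + z := by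
        intro z; rw [Complex.ofReal_ofNat, two_smul]
      rw [h2]
      noncomm_ring
    have i1 : cls b ≤ cls (((2 : ℝ) : ℂ) • ((1 - G) * b * (1 - G)ᴴ + G * b * Gᴴ)) :=
      cls_le.2 (mle_of_le hb (by rw [e1]; exact hb.conj _))
    refine i1.trans ((cls_le.2 (mle_smul _ (by norm_num))).trans ((cls_add_le _ _).trans
      (add_le_add le_rfl ?_)))
    have hN0 := nrm_nonneg b
    have p1 := (m_le_nrm hbs le_rfl).conj G
    have p2 := hGG.smul hN0
    have p3 := hGσ.smul hN0
    have p4 := (p1.add p2).add p3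
    have e2 : G * ((nrm b : ℂ) • (1 : Matrix (Fin m) (Fin m) A) - b) * Gᴴ +
        (nrm b : ℂ) • (G - G * G) + (nrm b : ℂ) • ((σ : ℂ) • s - G) =
        ((nrm b * σ : ℝ) : ℂ) • s - G * b * Gᴴ := by
      rw [hGs, Matrix.mul_sub, Matrix.sub_mul, Matrix.mul_smul, Matrix.smul_mul, Matrix.mul_one,
        smul_sub, smul_sub, smul_smul, Complex.ofReal_mul]
      abel
    rw [e2] at p4
    refine (cls_le.2 (mle_of_le (hb.conj G) p4)).trans
      ((cls_le.2 (mle_smul _ (by positivity))).trans ?_)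
    rw [hs2]
    exact cls_le.2 (mle_conj _ _)

theorem semi_arith {W : Type} [AddCommMonoid W] [PartialOrder W] [IsOrderedAddMonoid W]
    (hW : ∀ x : W, 0 ≤ x) {a b b1 c : W} {k L : ℕ} (hk : 1 ≤ k) (h1 : (k + 1) • a ≤ k • b)
    (h2 : b ≤ b1 + c) (h3 : (2 * k) • c ≤ a) (h4 : a ≤ L • b1) :
    ∃ K : ℕ, 1 ≤ K ∧ (K + 1) • a ≤ K • b1 := by
  have h5 : (2 * k + 2) • a ≤ (2 * k) • b1 + a := by
    calc (2 * k + 2) • a = 2 • ((k + 1) • a) := by rw [smul_smul]; congr 1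
      _ ≤ 2 • (k • b) := nsmul_le_nsmul_right h1 2
      _ = (2 * k) • b := by rw [smul_smul]
      _ ≤ (2 * k) • (b1 + c) := nsmul_le_nsmul_right h2 _
      _ = (2 * k) • b1 + (2 * k) • c := smul_add _ _ _
      _ ≤ _ := add_le_add le_rfl h3
  have h6 : ∀ m : ℕ, (m * (2 * k + 1) + 1) • a ≤ (m * (2 * k)) • b1 + a := by
    intro m
    induction m with
    | zero => simp
    | succ m ih =>
      calc ((m + 1) * (2 * k + 1) + 1) • a = (m * (2 * k + 1)) • a + (2 * k + 2) • a := by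
            rw [← add_smul]; congr 1; ring
        _ ≤ (m * (2 * k + 1)) • a + ((2 * k) • b1 + a) := add_le_add le_rfl h5
        _ = (m * (2 * k + 1) + 1) • a + (2 * k) • b1 := by rw [add_smul, one_smul]; abel
        _ ≤ (m * (2 * k)) • b1 + a + (2 * k) • b1 := add_le_add ih le_rfl
        _ = _ := by rw [add_mul m 1, add_smul, one_mul]; abel
  refine ⟨(L + 1) * (2 * k) + L, by nlinarith, ?_⟩
  calc ((L + 1) * (2 * k) + L + 1) • a ≤ ((L + 1) * (2 * k + 1) + 1) • a :=
        nsmul_le_nsmul_left (hW a) (by nlinarith)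
    _ ≤ _ := h6 (L + 1)
    _ ≤ ((L + 1) * (2 * k)) • b1 + L • b1 := add_le_add le_rfl h4
    _ = _ := by rw [add_smul]

theorem ne_reduce (hs : IsSimpleCStarAlgebra A) (hN : NonElem A) {n m : ℕ}
    {a : Matrix (Fin n) (Fin n) A} (ha : MatPos a) (ha0 : a ≠ 0)
    {b : Matrix (Fin m) (Fin m) A} (hb : MatPos b) (hb0 : b ≠ 0) {k : ℕ} (hk : 1 ≤ k)
    (h : (k + 1) • cls a ≤ k • cls b) :
    ∃ (b1 : Matrix (Fin m) (Fin m) A) (c : A) (K : ℕ), MatPos b1 ∧ MatPos (one1 c) ∧ c ≠ 0 ∧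
      1 ≤ K ∧ (K + 1) • cls a ≤ K • cls b1 ∧ cls b1 + n • cls (one1 c) ≤ cls b := by
  obtain ⟨c0, h1, h2, h3⟩ := divide hs hN (2 * k) ha ha0
  obtain ⟨b1, b0, h4, h5, h6, h7, h8, h9⟩ := split hs hN hb hb0 h1 h2
  obtain ⟨L, hL⟩ := absorb hs ha h4 h5
  obtain ⟨K, hK, hK'⟩ := semi_arith cls_nonneg hk h h9 h3 hL
  obtain ⟨c1, g1, g2, g3⟩ := divide hs hN n h6 h7
  obtain ⟨c, g4, g5, g6⟩ := exists_elem g1 g2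
  exact ⟨b1, c, K, h4, g5, g4, hK, hK', (add_le_add le_rfl
    ((nsmul_le_nsmul_right g6 n).trans g3)).trans h8⟩

end U


section V
variable {A : Type} [CStarAlgebra A]

theorem scalar_of_sq {M : Type} [Ring M] [Algebra ℂ M] {e h : M} (he0 : e ≠ 0) (hee : e * e = e)
    (heh : e * h = h) (hhe : h * e = h) (h1 : ∃ μ : ℝ, h * h = (μ : ℂ) • h)
    (h2 : ∃ μ : ℝ, (e + h) * (e + h) = (μ : ℂ) • (e + h))
    (h3 : ∃ μ : ℝ, (e + (h + h)) * (e + (h + h)) = (μ : ℂ) • (e + (h + h))) :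
    ∃ l : ℂ, h = l • e := by
  obtain ⟨m, hm⟩ := h1
  obtain ⟨n, hn⟩ := h2
  obtain ⟨p, hp⟩ := h3
  have hn' : ((2 + m - n : ℂ)) • h = ((n : ℂ) - 1) • e := by
    have : (e + h) * (e + h) = e + (2 + m : ℂ) • h := by
      rw [add_mul, mul_add, mul_add, hee, heh, hhe, hm, add_smul, two_smul]; abel
    rw [this, smul_add] at hn
    rw [sub_smul, sub_smul, one_smul, sub_eq_sub_iff_add_eq_add, add_comm, hn]
  have key : ∀ c d : ℂ, c ≠ 0 → c • h = d • e → ∃ l : ℂ, h = l • e := by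
    intro c d hc hcd
    refine ⟨c⁻¹ * d, ?_⟩
    rw [mul_smul, ← hcd, smul_smul, inv_mul_cancel₀ hc, one_smul]
  by_cases hc : (2 + m - n : ℂ) = 0
  · rw [hc, zero_smul] at hn'
    have hn1 : (n : ℂ) - 1 = 0 := by
      by_contra hne
      exact he0 ((smul_eq_zero_iff_right hne).1 hn'.symm)
    have hm1 : (m : ℂ) = -1 := by linear_combination hc + hn1
    have hhh : h * h = - h := by rw [hm, hm1]; simp
    have : (e + (h + h)) * (e + (h + h)) = e := by
      rw [add_mul, mul_add, mul_add, mul_add, add_mul, add_mul, hee, heh, hhe, mul_add, hhh]; abel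
    rw [this] at hp
    have hp0 : (p : ℂ) ≠ 0 := by
      intro h0; rw [h0, zero_smul] at hp; exact he0 hp
    refine key (2 * p) (1 - p) (by simpa using hp0) ?_
    rw [sub_smul, one_smul, eq_sub_iff_add_eq]
    conv_rhs => rw [hp]
    rw [smul_add, ← two_smul ℂ h, smul_smul, mul_comm (p : ℂ) 2, add_comm]
  · exact key _ _ hc hn'

theorem proj_dichotomy {q : A} (hq : q * q = q) {l : ℂ} (h : ‖q - l • (1 : A)‖ < 1 / 2) :
    q = 0 ∨ q = 1 := by
  by_contra! hc
  have k1 : ‖1 - l‖ ≤ ‖q - l • (1 : A)‖ := by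
    have hpos : 0 < ‖q‖ := norm_pos_iff.2 hc.1
    have : ‖1 - l‖ * ‖q‖ ≤ ‖q - l • (1 : A)‖ * ‖q‖ := by
      have e : (1 - l) • q = (q - l • (1 : A)) * q := by
        rw [sub_mul, hq, smul_mul_assoc, one_mul, sub_smul, one_smul]
      rw [← norm_smul, e]
      exact norm_mul_le _ _
    exact le_of_mul_le_mul_right this hpos
  have k2 : ‖l‖ ≤ ‖q - l • (1 : A)‖ := by
    have hpos : 0 < ‖1 - q‖ := norm_pos_iff.2 (sub_ne_zero.2 (Ne.symm hc.2))
    have : ‖-l‖ * ‖1 - q‖ ≤ ‖q - l • (1 : A)‖ * ‖1 - q‖ := by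
      have e : (-l) • (1 - q) = (q - l • (1 : A)) * (1 - q) := by
        rw [sub_mul, mul_sub, mul_one, hq, smul_mul_assoc, one_mul, neg_smul]; simp
      rw [← norm_smul, e]
      exact norm_mul_le _ _
    rw [norm_neg] at this
    exact le_of_mul_le_mul_right this hpos
  have : (1 : ℝ) ≤ ‖1 - l‖ + ‖l‖ := by
    have := norm_add_le (1 - l) l
    simpa using this
  linarith

theorem elem_case (hs : IsSimpleCStarAlgebra A) (hN : ¬ NonElem A) :
    ∃ (F : Finset A) (ε : ℝ), 0 < ε ∧ ∀ q : A, IsSelfAdjoint q → q * q = q →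
      (∀ x ∈ F, ‖q * x - x * q‖ ≤ ε) → q = 0 ∨ q = 1 := by
  classical
  unfold NonElem at hN
  push Not at hN
  obtain ⟨n, d, hd, hd0, hX⟩ := hN
  have hds := matPos_star hd
  obtain ⟨ν, hν⟩ := hX 1 (by simp)
  rw [Matrix.mul_one] at hν
  have hdd : d * d ≠ 0 := fun h => hd0 (m_zero' (by rwa [hds]))
  have hddd : (d * d) * (d * d) ≠ 0 := fun h => hdd (m_zero' (by
    rwa [conjTranspose_mul, hds]))
  have hν0 : (ν : ℂ) ≠ 0 := by
    intro h0; rw [h0, zero_smul] at hν; exact hddd hν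
  set e := ((ν⁻¹ : ℝ) : ℂ) • (d * d) with he
  have hes : eᴴ = e := by
    rw [he, conjTranspose_smul, conjTranspose_mul, hds]; simp
  have hee : e * e = e := by
    rw [he, Matrix.smul_mul, Matrix.mul_smul, hν, smul_smul, smul_smul]
    congr 1
    push_cast
    field_simp
  have he0 : e ≠ 0 := by
    rw [he]; exact smul_ne_zero (by push_cast; exact inv_ne_zero hν0) hdd
  have hE : ∀ X : Matrix (Fin n) (Fin n) A, Xᴴ = X →
      ∃ μ : ℝ, (e * X * e) * (e * X * e) = (μ : ℂ) • (e * X * e) := by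
    intro X hXs
    have : e * X * e = d * (((ν⁻¹ * ν⁻¹ : ℝ) : ℂ) • (d * X * d)) * d := by
      rw [he]
      simp only [Matrix.smul_mul, Matrix.mul_smul, smul_smul, Matrix.mul_assoc]
      push_cast; rfl
    rw [this]
    apply hX
    rw [conjTranspose_smul, conjTranspose_mul, conjTranspose_mul, hds, hXs]; simp [Matrix.mul_assoc]
  have hsc : ∀ X : Matrix (Fin n) (Fin n) A, Xᴴ = X → ∃ l : ℂ, e * X * e = l • e := by
    intro X hXs
    refine scalar_of_sq he0 hee ?_ ?_ (hE X hXs) ?_ ?_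
    · rw [← Matrix.mul_assoc, ← Matrix.mul_assoc, hee]
    · rw [Matrix.mul_assoc, hee]
    · have := hE (1 + X) (by rw [conjTranspose_add, hXs, conjTranspose_one])
      rwa [Matrix.mul_add, Matrix.add_mul, Matrix.mul_one, hee] at this
    · have := hE (1 + (X + X)) (by
        rw [conjTranspose_add, conjTranspose_add, hXs, conjTranspose_one])
      have e1 : e * (1 + (X + X)) * e = e + (e * X * e + e * X * e) := by
        rw [Matrix.mul_add, Matrix.mul_add, Matrix.add_mul, Matrix.add_mul, Matrix.mul_one, hee]
      rwa [e1] at this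
  obtain ⟨i, j, hij⟩ : ∃ i j, e i j ≠ 0 := by
    by_contra! h; exact he0 (by ext i j; exact h i j)
  obtain ⟨L, x, y, hxy⟩ := simple_unit hs hij
  set C : ℝ := ∑ l, (‖e i j * y l‖ + ‖x l‖ * (n * n * nrm e) * ‖y l‖) with hC
  have hC0 : 0 ≤ C := Finset.sum_nonneg fun l _ => by have := nrm_nonneg e; positivity
  refine ⟨Finset.univ.image x ∪ Finset.univ.image (fun p : Fin n × Fin n => e p.1 p.2),
    1 / (4 * (C + 1)), by positivity, ?_⟩
  intro q hqs hqq hF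
  set δ := 1 / (4 * (C + 1)) with hδ
  have hδ0 : 0 < δ := by positivity
  have hx : ∀ l, ‖q * x l - x l * q‖ ≤ δ := fun l => hF _ (by simp)
  have he' : ∀ i j, ‖q * e i j - e i j * q‖ ≤ δ := fun i j => hF _ (by simp; exact Or.inr ⟨i, j, rfl⟩)
  let Q : Matrix (Fin n) (Fin n) A := Matrix.diagonal fun _ => q
  have hQ : Qᴴ = Q := by
    simp only [Q, Matrix.diagonal_conjTranspose]
    congr 1; ext i; exact hqs
  obtain ⟨l, hl⟩ := hsc Q hQ
  have h1 : nrm (Q * e - e * Q) ≤ n * n * δ := by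
    have := nrm_le_of_entry (Q * e - e * Q) (c := δ) (fun i j => by
      simpa [Q, Matrix.diagonal_mul, Matrix.mul_diagonal] using he' i j)
    simpa using this
  have h2 : nrm (Q * e - l • e) ≤ n * n * δ * nrm e := by
    have : Q * e - l • e = (Q * e - e * Q) * e := by
      rw [Matrix.sub_mul, hl, Matrix.mul_assoc, hee]
    rw [this]
    refine (nrm_mul _ _).trans ?_
    gcongr
    exact nrm_nonneg _
  have h3 : ‖q * e i j - l • e i j‖ ≤ n * n * δ * nrm e := by
    refine le_trans ?_ h2
    have := entry_le_nrm (Q * e - l • e) i j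
    simpa [Q, Matrix.diagonal_mul] using this
  apply proj_dichotomy hqq (l := l)
  have h4 : q - l • (1 : A) = ∑ t, ((q * x t - x t * q) * (e i j * y t) +
      x t * (q * e i j - l • e i j) * y t) := by
    conv_lhs => rw [← hxy, ← mul_one q, ← hxy]
    rw [Finset.mul_sum, Finset.smul_sum, ← Finset.sum_sub_distrib]
    refine Finset.sum_congr rfl fun t _ => ?_
    simp only [mul_sub, sub_mul, mul_smul_comm, smul_mul_assoc, mul_assoc]
    abel
  have h5 : ‖q - l • (1 : A)‖ ≤ δ * C := by
    rw [h4, hC, Finset.mul_sum]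
    refine (norm_sum_le _ _).trans (Finset.sum_le_sum fun t _ => ?_)
    refine (norm_add_le _ _).trans ?_
    rw [mul_add]
    refine add_le_add ?_ ?_
    · exact (norm_mul_le _ _).trans (by gcongr; exact hx t)
    · refine (norm_mul_le _ _).trans ?_
      calc ‖x t * (q * e i j - l • e i j)‖ * ‖y t‖
          ≤ (‖x t‖ * (n * n * δ * nrm e)) * ‖y t‖ := by
            gcongr
            exact (norm_mul_le _ _).trans (by gcongr)
        _ = _ := by ring
  refine h5.trans_lt ?_
  rw [hδ, div_mul_eq_mul_div, div_lt_iff₀ (by positivity)]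
  nlinarith

end V


section CP
variable {A B : Type} [CStarAlgebra A] [CStarAlgebra B] {ι κ μ : Type} [Fintype ι] [Fintype κ]
  [Fintype μ]

theorem cp_star {φ : A →ₗ[ℂ] B} (h : IsCPC φ) (x : A) : φ (star x) = star (φ x) := by
  have hp : MatPos ((!![(1 : A), x; 0, 0]ᴴ * !![(1 : A), x; 0, 0]).map φ) := h.2 2 _ ⟨_, rfl⟩
  have h1 := congrFun (congrFun (matPos_star hp) 1) 0
  simp [Matrix.mul_apply, Fin.sum_univ_two, Matrix.conjTranspose_apply] at h1
  exact h1.symm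

theorem cp_conjTranspose {φ : A →ₗ[ℂ] B} (h : IsCPC φ) (a : Matrix ι κ A) :
    aᴴ.map φ = (a.map φ)ᴴ := by
  ext i j
  simp [Matrix.conjTranspose_apply, cp_star h]

theorem cp_pos {φ : A →ₗ[ℂ] B} (h : IsCPC φ) {a : Matrix ι ι A} (ha : MatPos a) :
    MatPos (a.map φ) := by
  have := h.2 _ _ (matPos_submatrix ha (Fintype.equivFin ι).symm)
  have := matPos_submatrix this (Fintype.equivFin ι)
  convert this
  ext i j
  simp

theorem cp_nrm {φ : A →ₗ[ℂ] B} (h : IsCPC φ) (a : Matrix ι κ A) : nrm (a.map φ) ≤ nrm a := by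
  unfold nrm
  gcongr with i _ j _
  exact h.1 _

theorem lin_sub (φ : A →ₗ[ℂ] B) (a b : Matrix ι κ A) : (a - b).map φ = a.map φ - b.map φ :=
  Matrix.map_sub φ (map_sub φ) a b

theorem lin_add (φ : A →ₗ[ℂ] B) (a b : Matrix ι κ A) : (a + b).map φ = a.map φ + b.map φ :=
  Matrix.map_add φ (map_add φ) a b

theorem lin_smul (φ : A →ₗ[ℂ] B) (r : ℂ) (a : Matrix ι κ A) : (r • a).map φ = r • a.map φ := by
  ext i j; simp

theorem lin_matRep (φ : A →ₗ[ℂ] B) (k : ℕ) (a : Matrix ι ι A) :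
    (matRep k a).map φ = matRep k (a.map φ) :=
  Matrix.blockDiagonal_map _ _ (map_zero φ)

theorem matRep_mul (k : ℕ) (a b : Matrix ι ι A) : matRep k (a * b) = matRep k a * matRep k b :=
  Matrix.blockDiagonal_mul _ _

theorem matRep_conjTranspose (k : ℕ) (a : Matrix ι ι A) : (matRep k a)ᴴ = matRep k aᴴ :=
  Matrix.blockDiagonal_conjTranspose _

theorem matRep_sub (k : ℕ) (a b : Matrix ι ι A) : matRep k (a - b) = matRep k a - matRep k b :=
  Matrix.blockDiagonal_sub (fun _ : Fin k => a) (fun _ => b)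

theorem matRep_smul (k : ℕ) (r : ℂ) (a : Matrix ι ι A) : matRep k (r • a) = r • matRep k a :=
  Matrix.blockDiagonal_smul r (fun _ : Fin k => a)

theorem matRep_one [DecidableEq ι] (k : ℕ) : matRep k (1 : Matrix ι ι A) = 1 :=
  Matrix.blockDiagonal_one

theorem matRep_pos (k : ℕ) {a : Matrix ι ι A} (h : MatPos a) : MatPos (matRep k a) := by
  obtain ⟨c, rfl⟩ := h
  exact ⟨matRep k c, by rw [matRep_mul, matRep_conjTranspose]⟩

theorem nrm_matRep (k : ℕ) (a : Matrix ι ι A) : nrm (matRep k a) = k * nrm a := by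
  unfold nrm matRep
  simp only [Fintype.sum_prod_type, Matrix.blockDiagonal_apply]
  have : ∀ (i : ι) (x : Fin k), ∑ j : ι, ∑ y : Fin k, ‖if x = y then a i j else 0‖ =
      ∑ j, ‖a i j‖ := by
    intro i x
    refine Finset.sum_congr rfl fun j _ => ?_
    rw [Finset.sum_eq_single x] <;> simp +contextual [eq_comm]
  simp only [this]
  simp [Finset.mul_sum]

theorem map_mul_err (φ : A →ₗ[ℂ] B) (x : Matrix ι κ A) (y : Matrix κ μ A) :
    nrm (x.map φ * y.map φ - (x * y).map φ) ≤
      ∑ i, ∑ j, ∑ k, ‖φ (x i k) * φ (y k j) - φ (x i k * y k j)‖ := by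
  unfold nrm
  gcongr with i _ j _
  rw [Matrix.sub_apply, Matrix.mul_apply, Matrix.map_apply, Matrix.mul_apply, map_sum,
    ← Finset.sum_sub_distrib]
  exact norm_sum_le _ _

theorem map_mul_err' (φ : A →ₗ[ℂ] B) (x : Matrix ι κ A) (y : Matrix κ μ A) {ε : ℝ}
    (h : ∀ i k j, ‖φ (x i k) * φ (y k j) - φ (x i k * y k j)‖ ≤ ε) :
    nrm (x.map φ * y.map φ - (x * y).map φ) ≤
      Fintype.card ι * Fintype.card μ * Fintype.card κ * ε := by
  refine (map_mul_err φ x y).trans ?_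
  calc _ ≤ ∑ _i : ι, ∑ _j : μ, ∑ _k : κ, ε := by gcongr with i _ j _ k _; exact h i k j
    _ = _ := by simp; ring

/-- the finite set of entries of a matrix -/
noncomputable def entries (x : Matrix ι κ A) : Finset A := by
  classical exact Finset.univ.image fun p : ι × κ => x p.1 p.2

theorem mem_entries (x : Matrix ι κ A) (i : ι) (j : κ) : x i j ∈ entries x := by
  classical
  unfold entries
  exact Finset.mem_image.2 ⟨(i, j), Finset.mem_univ _, rfl⟩

/-- a self-adjoint small difference gives an inequality -/
theorem pos_of_nrm [DecidableEq ι] {x y : Matrix ι ι A} (hx : xᴴ = x) (hy : yᴴ = y) {δ : ℝ}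
    (h : nrm (y - x) ≤ δ) : MatPos (y - (x - (δ : ℂ) • (1 : Matrix ι ι A))) := by
  have := m_le_nrm (x := x - y) (by rw [conjTranspose_sub, hx, hy]) (δ := δ)
    (by rw [nrm_sub_comm]; exact h)
  convert this using 1
  abel

/-- cutting down : if `x - δ ≤ y` then an approximation of `x` is below `y` -/
theorem cut_le [DecidableEq ι] {x y : Matrix ι ι A} (hx : MatPos x) {δ : ℝ} (hδ : 0 < δ)
    (h : MatPos (y - (x - (δ : ℂ) • (1 : Matrix ι ι A)))) :
    ∃ u r : Matrix ι ι A, rᴴ = r ∧ u = r * (x - (δ : ℂ) • (1 : Matrix ι ι A)) * r ∧ MatPos u ∧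
      nrm (x - u) ≤ Fintype.card ι * Fintype.card ι * (2 * δ) ∧ MatCuntzLE u y := by
  obtain ⟨r, hr, h1, h2⟩ := m_cut hx hδ
  refine ⟨_, r, hr, rfl, h1, h2, mle_trans (mle_of_le h1 ?_) (mle_conj y r)⟩
  have := h.conj r
  rw [hr] at this ⊢
  convert this using 1
  noncomm_ring

theorem transfer_alpha {n m : ℕ} {a : Matrix (Fin n) (Fin n) A} {b : Matrix (Fin m) (Fin m) A}
    (ha : MatPos a) (hb : MatPos b) {K : ℕ} (hK : 1 ≤ K)
    (h : MatCuntzLE (matRep (K + 1) a) (matRep K b)) {δ : ℝ} (hδ : 0 < δ) :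
    ∃ (F : Finset A) (ε η : ℝ), 0 < ε ∧ 0 < η ∧ ∀ (B : Type) [CStarAlgebra B],
      AlmostUnperforatedW B → ∀ α : A →ₗ[ℂ] B, IsCPC α →
      (∀ x ∈ F, ∀ y ∈ F, ‖α x * α y - α (x * y)‖ ≤ ε) →
      ∃ U : Matrix (Fin n) (Fin m) B,
        nrm (U * (b.map α - (η : ℂ) • (1 : Matrix (Fin m) (Fin m) B)) * Uᴴ - a.map α) ≤
          δ + n * n * (6 * δ) := by
  classical
  obtain ⟨R, hR⟩ := mle_iff.1 h δ hδ
  set bh := matRep K b with hbh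
  set ah := matRep (K + 1) a with hah
  set N1 : ℝ := Fintype.card (Fin n × Fin (K + 1)) * Fintype.card (Fin m × Fin K) *
    Fintype.card (Fin m × Fin K) with hN1
  set N2 : ℝ := Fintype.card (Fin n × Fin (K + 1)) * Fintype.card (Fin n × Fin (K + 1)) *
    Fintype.card (Fin m × Fin K) with hN2
  have hN1' : 0 ≤ N1 := by positivity
  have hN2' : 0 ≤ N2 := by positivity
  have hR0 := nrm_nonneg R
  set C := N1 * nrm R + N2 with hC
  have hC0 : 0 ≤ C := by positivity
  set C' := nrm R * (K * (m * m * 2)) * nrm R with hC'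
  have hC0' : 0 ≤ C' := by positivity
  refine ⟨entries R ∪ entries bh ∪ entries (R * bh) ∪ entries Rᴴ, δ / (C + 1), δ / (C' + 1),
    by positivity, by positivity, ?_⟩
  intro B _ hB α hα hmul
  set ε := δ / (C + 1) with hε
  set η := δ / (C' + 1) with hη
  have hε0 : 0 < ε := by positivity
  have hη0 : 0 < η := by positivity
  have hCε : C * ε ≤ δ := by
    rw [hε, mul_div_assoc', div_le_iff₀ (by positivity)]; nlinarith
  have hCη : C' * η ≤ δ := by
    rw [hη, mul_div_assoc', div_le_iff₀ (by positivity)]; nlinarith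
  have hy : MatPos (b.map α) := cp_pos hα hb
  have hx : MatPos (a.map α) := cp_pos hα ha
  set y := b.map α with hydef
  have hbα : bh.map α = matRep K y := lin_matRep α K b
  have haα : ah.map α = matRep (K + 1) (a.map α) := lin_matRep α (K + 1) a
  set S := R.map α with hS
  have hSn : nrm S ≤ nrm R := cp_nrm hα R
  have hSs : Rᴴ.map α = Sᴴ := cp_conjTranspose hα R
  have k1 : nrm (S * matRep K y - (R * bh).map α) ≤ N1 * ε := by
    rw [← hbα]
    refine map_mul_err' α R bh fun i k j => hmul _ ?_ _ ?_
    · simp [mem_entries]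
    · simp [mem_entries]
  have k2 : nrm ((R * bh).map α * Sᴴ - (R * bh * Rᴴ).map α) ≤ N2 * ε := by
    rw [← hSs]
    refine map_mul_err' α (R * bh) Rᴴ fun i k j => hmul _ ?_ _ ?_
    · have := mem_entries (R * bh) i k
      simp [this]
    · have := mem_entries Rᴴ k j
      simp only [Finset.mem_union, this, or_true]
  have k3 : nrm (S * matRep K y * Sᴴ - ah.map α) ≤ 2 * δ := by
    have e1 : nrm (S * matRep K y * Sᴴ - (R * bh).map α * Sᴴ) ≤ N1 * ε * nrm R := by
      rw [← Matrix.sub_mul]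
      refine (nrm_mul _ _).trans ?_
      rw [nrm_star]
      gcongr
      exact nrm_nonneg _
    have e2 : nrm ((R * bh * Rᴴ).map α - ah.map α) ≤ δ := by
      rw [← lin_sub]
      exact (cp_nrm hα _).trans hR.le
    have t1 := nrm_sub_le (S * matRep K y * Sᴴ) ((R * bh).map α * Sᴴ) (ah.map α)
    have t2 := nrm_sub_le ((R * bh).map α * Sᴴ) ((R * bh * Rᴴ).map α) (ah.map α)
    have : N1 * ε * nrm R + N2 * ε ≤ δ := by
      refine le_trans (le_of_eq ?_) hCε
      rw [hC]; ring
    linarith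
  obtain ⟨r, hr, hz, hyz⟩ := m_cut hy hη0
  set z := r * (y - (η : ℂ) • (1 : Matrix (Fin m) (Fin m) B)) * r with hzdef
  have k4 : nrm (S * matRep K z * Sᴴ - S * matRep K y * Sᴴ) ≤ δ := by
    rw [← Matrix.sub_mul, ← Matrix.mul_sub, ← matRep_sub]
    refine le_trans ?_ hCη
    refine (nrm_mul _ _).trans ?_
    rw [nrm_star]
    calc nrm (S * matRep K (z - y)) * nrm S
        ≤ (nrm R * (K * (Fintype.card (Fin m) * Fintype.card (Fin m) * (2 * η)))) * nrm R := by
          refine mul_le_mul ?_ hSn (nrm_nonneg _) (by positivity)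
          refine (nrm_mul _ _).trans ?_
          rw [nrm_matRep, nrm_sub_comm]
          exact mul_le_mul hSn (mul_le_mul_of_nonneg_left hyz (by positivity))
            (mul_nonneg (by positivity) (nrm_nonneg _)) hR0
      _ = C' * η := by rw [hC']; simp; ring
  have k5 : nrm (S * matRep K z * Sᴴ - matRep (K + 1) (a.map α)) ≤ 3 * δ := by
    rw [← haα]
    have := nrm_sub_le (S * matRep K z * Sᴴ) (S * matRep K y * Sᴴ) (ah.map α)
    linarith
  obtain ⟨r1, hr1, h1, h2⟩ := m_cut hx (δ := 3 * δ) (by positivity)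
  set a2 := r1 * (a.map α - ((3 * δ : ℝ) : ℂ) • (1 : Matrix (Fin n) (Fin n) B)) * r1 with ha2
  have hzr := matRep_pos K hz
  have k6 : MatCuntzLE (matRep (K + 1) a2) (matRep K z) := by
    refine mle_trans (mle_of_le (x := matRep (K + 1) r1 * (S * matRep K z * Sᴴ) *
      (matRep (K + 1) r1)ᴴ) (matRep_pos _ h1) ?_) (mle_trans (mle_conj _ _) (mle_conj _ _))
    have := (pos_of_nrm (matPos_star (matRep_pos (K + 1) hx)) (matPos_star (hzr.conj S)) k5).conj
      (matRep (K + 1) r1)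
    have e4 : matRep (K + 1) a2 = matRep (K + 1) r1 * (matRep (K + 1) (a.map α) -
        ((3 * δ : ℝ) : ℂ) • (1 : Matrix (Fin n × Fin (K + 1)) (Fin n × Fin (K + 1)) B)) *
        matRep (K + 1) r1 := by
      rw [← matRep_one, ← matRep_smul, ← matRep_sub, ← matRep_mul, ← matRep_mul]
    rw [matRep_conjTranspose, hr1] at this ⊢
    rw [e4, ← Matrix.sub_mul, ← Matrix.mul_sub]
    exact this
  have k7 : MatCuntzLE a2 z := hB n m a2 z h1 hz K hK k6
  obtain ⟨w, hw⟩ := mle_iff.1 k7 δ hδ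
  refine ⟨w * r, ?_⟩
  have e3 : w * r * (y - (η : ℂ) • (1 : Matrix (Fin m) (Fin m) B)) * (w * r)ᴴ = w * z * wᴴ := by
    rw [hzdef, conjTranspose_mul, hr]; simp only [Matrix.mul_assoc]
  rw [e3]
  have t := nrm_sub_le (w * z * wᴴ) a2 (a.map α)
  rw [nrm_sub_comm a2] at t
  simp only [Fintype.card_fin] at h2
  linarith

end CP


section BT
variable {A B : Type} [CStarAlgebra A] [CStarAlgebra B] {ι κ μ : Type} [Fintype ι] [Fintype κ]
  [Fintype μ]

theorem tendsto_map_mul {β : ℕ → (B →ₗ[ℂ] A)}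
    (hmul : ∀ x y : B, Tendsto (fun n => ‖β n (x * y) - β n x * β n y‖) atTop (𝓝 0))
    (x : Matrix ι κ B) (y : Matrix κ μ B) :
    Tendsto (fun n => nrm (x.map (β n) * y.map (β n) - (x * y).map (β n))) atTop (𝓝 0) := by
  refine squeeze_zero (fun _ => nrm_nonneg _) (fun n => map_mul_err (β n) x y) ?_
  have : Tendsto (fun n => ∑ i, ∑ j, ∑ k,
      ‖β n (x i k) * β n (y k j) - β n (x i k * y k j)‖) atTop
      (𝓝 (∑ _i : ι, ∑ _j : μ, ∑ _k : κ, (0 : ℝ))) := by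
    refine tendsto_finsetSum _ fun i _ => tendsto_finsetSum _ fun j _ =>
      tendsto_finsetSum _ fun k _ => ?_
    refine (hmul (x i k) (y k j)).congr fun n => ?_
    rw [norm_sub_rev]
  simpa using this

theorem transfer_beta {n m : ℕ} {a : Matrix (Fin n) (Fin n) A} {b : Matrix (Fin m) (Fin m) A}
    (ha : MatPos a) (hb : MatPos b) {α : A →ₗ[ℂ] B} (hα : IsCPC α) {β : ℕ → (B →ₗ[ℂ] A)}
    {γ : ℕ → (A →ₗ[ℂ] A)} (hβ : ∀ k, IsCPC (β k))
    (horth : ∀ (n : ℕ) (x : A) (b : B), γ n x * β n b = 0 ∧ β n b * γ n x = 0)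
    (hproj : ∀ n : ℕ, IsIdempotentElem (β n 1) ∧ IsSelfAdjoint (β n 1) ∧
          IsIdempotentElem (γ n 1) ∧ IsSelfAdjoint (γ n 1) ∧ β n 1 + γ n 1 = 1)
    (hmul : ∀ x y : B, Tendsto (fun n => ‖β n (x * y) - β n x * β n y‖) atTop (𝓝 0))
    {ε η δ D : ℝ} (hεη : m * m * ε ≤ η) (hδ : 0 < δ) (hD : 0 ≤ D)
    (hclose : ∀ i j k, ‖b i j - γ k (b i j) - β k (α (b i j))‖ ≤ ε)
    (U : Matrix (Fin n) (Fin m) B)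
    (hU : nrm (U * (b.map α - (η : ℂ) • (1 : Matrix (Fin m) (Fin m) B)) * Uᴴ - a.map α) ≤ D) :
    ∀ᶠ k in atTop, ∃ u : Matrix (Fin n) (Fin n) A, MatPos u ∧
      nrm (u - (a.map α).map (β k)) ≤ n * n * (2 * (D + δ)) ∧ MatCuntzLE u b := by
  classical
  set Y := b.map α - (η : ℂ) • (1 : Matrix (Fin m) (Fin m) B) with hY
  have hU0 := nrm_nonneg U
  have l1 : Tendsto (fun k => nrm (U.map (β k) * Y.map (β k) - (U * Y).map (β k)) * nrm U +
      nrm ((U * Y).map (β k) * Uᴴ.map (β k) - (U * Y * Uᴴ).map (β k))) atTop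
      (𝓝 (0 * nrm U + 0)) :=
    ((tendsto_map_mul hmul U Y).mul_const _).add (tendsto_map_mul hmul (U * Y) Uᴴ)
  rw [zero_mul, zero_add] at l1
  filter_upwards [l1.eventually (gt_mem_nhds hδ)] with k hk
  obtain ⟨hqq, hqs, -, -, hq1⟩ := hproj k
  set q := β k 1 with hq
  let Q : Matrix (Fin m) (Fin m) A := Matrix.diagonal fun _ => q
  have hQs : Qᴴ = Q := by
    simp only [Q, Matrix.diagonal_conjTranspose]
    congr 1; ext i; exact hqs
  have hβq : ∀ x, β k x * q = β k x := by
    intro x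
    have := (horth k 1 x).2
    rw [← eq_sub_iff_add_eq'] at hq1
    rw [hq1, mul_sub, mul_one, sub_eq_zero] at this
    exact this.symm
  have hqβ : ∀ x, q * β k x = β k x := by
    intro x
    have := (horth k 1 x).1
    rw [← eq_sub_iff_add_eq'] at hq1
    rw [hq1, sub_mul, one_mul, sub_eq_zero] at this
    exact this.symm
  set T := U.map (β k) with hT
  have hTs : Uᴴ.map (β k) = Tᴴ := cp_conjTranspose (hβ k) U
  have hTQ : T * Q = T := by
    ext i j
    simp only [Q, Matrix.mul_diagonal, hT, Matrix.map_apply, hβq]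
  have hQT : Q * Tᴴ = Tᴴ := by
    have := congrArg conjTranspose hTQ
    rwa [conjTranspose_mul, hQs] at this
  have hy : MatPos ((b.map α).map (β k)) := cp_pos (hβ k) (cp_pos hα hb)
  have hx : MatPos ((a.map α).map (β k)) := cp_pos (hβ k) (cp_pos hα ha)
  set y := (b.map α).map (β k) with hydef
  set x := (a.map α).map (β k) with hxdef
  have hYβ : Y.map (β k) = y - (η : ℂ) • Q := by
    rw [hY, lin_sub, lin_smul]
    congr 2
    ext i j
    simp only [Q, Matrix.map_apply, Matrix.one_apply, Matrix.diagonal_apply]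
    split_ifs <;> simp [hq]
  have hTY : T * Y.map (β k) * Tᴴ = T * (y - (η : ℂ) • (1 : Matrix (Fin m) (Fin m) A)) * Tᴴ := by
    rw [hYβ, Matrix.mul_sub, Matrix.mul_sub, Matrix.mul_smul, Matrix.mul_smul, hTQ, Matrix.mul_one]
  have hbQ : nrm (Q * b * Q - y) ≤ η := by
    refine le_trans ?_ hεη
    have := nrm_le_of_entry (Q * b * Q - y) (c := ε) (fun i j => ?_)
    · simpa using this
    · have e : (Q * b * Q - y) i j = q * (b i j - γ k (b i j) - β k (α (b i j))) * q := by
        simp only [Q, Matrix.sub_apply, Matrix.mul_diagonal, Matrix.diagonal_mul, hydef,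
          Matrix.map_apply]
        rw [mul_sub, mul_sub, hq, (horth k (b i j) 1).2, ← hq, hqβ, sub_zero, sub_mul, hβq]
      rw [e]
      refine le_trans ?_ (hclose i j k)
      have hq1 : ‖q‖ ≤ 1 := by
        have h2 : ‖q‖ = ‖q‖ * ‖q‖ := by
          have := CStarRing.norm_star_mul_self (x := q)
          rw [hqs.star_eq, hqq] at this
          exact this
        nlinarith [norm_nonneg q]
      calc ‖q * (b i j - γ k (b i j) - β k (α (b i j))) * q‖
          ≤ ‖q‖ * ‖b i j - γ k (b i j) - β k (α (b i j))‖ * ‖q‖ :=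
            (norm_mul_le _ _).trans (by gcongr; exact norm_mul_le _ _)
        _ ≤ 1 * ‖b i j - γ k (b i j) - β k (α (b i j))‖ * 1 := by gcongr
        _ = _ := by ring
  have p1 : MatPos (T * b * Tᴴ - T * Y.map (β k) * Tᴴ) := by
    have hQbQ : (Q * b * Q)ᴴ = Q * b * Q := by
      simp only [conjTranspose_mul, hQs, matPos_star hb, Matrix.mul_assoc]
    have := (pos_of_nrm (matPos_star hy) hQbQ hbQ).conj T
    rw [Matrix.mul_sub, Matrix.sub_mul] at this
    rw [hTY]
    convert this using 2
    have : T * (Q * b * Q) * Tᴴ = (T * Q) * b * (Q * Tᴴ) := by simp only [Matrix.mul_assoc]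
    rw [this, hTQ, hQT]
  have hYs : (Y.map (β k))ᴴ = Y.map (β k) := by
    rw [hYβ, conjTranspose_sub, matPos_star hy, conjTranspose_smul, hQs]; simp
  have n1 : nrm (T * Y.map (β k) * Tᴴ - x) ≤ D + δ := by
    have e1 : nrm (T * Y.map (β k) * Tᴴ - (U * Y).map (β k) * Tᴴ) ≤
        nrm (T * Y.map (β k) - (U * Y).map (β k)) * nrm U := by
      rw [← Matrix.sub_mul]
      refine (nrm_mul _ _).trans ?_
      rw [nrm_star]
      exact mul_le_mul_of_nonneg_left (cp_nrm (hβ k) U) (nrm_nonneg _)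
    have e2 : nrm ((U * Y * Uᴴ).map (β k) - x) ≤ D := by
      rw [hxdef, ← lin_sub]
      exact (cp_nrm (hβ k) _).trans hU
    rw [hTs] at hk
    have t1 := nrm_sub_le (T * Y.map (β k) * Tᴴ) ((U * Y).map (β k) * Tᴴ) x
    have t2 := nrm_sub_le ((U * Y).map (β k) * Tᴴ) ((U * Y * Uᴴ).map (β k)) x
    linarith
  have p2 := pos_of_nrm (matPos_star hx) (y := T * Y.map (β k) * Tᴴ)
    (by simp only [conjTranspose_mul, hYs, conjTranspose_conjTranspose, Matrix.mul_assoc]) n1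
  have p3 := p1.add p2
  rw [sub_add_sub_cancel] at p3
  obtain ⟨u, r, -, -, hu, hu2, hu3⟩ := cut_le hx (by positivity) p3
  refine ⟨u, hu, ?_, mle_trans hu3 (mle_conj _ _)⟩
  rw [nrm_sub_comm]
  simpa using hu2

theorem main_step {P : BundledCStarAlgebra → Prop}
    (hP : ∀ B : BundledCStarAlgebra, P B → AlmostUnperforatedW B.carrier)
    (hA : AsympTraciallyIn P A) [Nontrivial A] {n m : ℕ} {a : Matrix (Fin n) (Fin n) A}
    {b : Matrix (Fin m) (Fin m) A}
    (ha : MatPos a) (hb : MatPos b) {K : ℕ} (hK : 1 ≤ K)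
    (h : MatCuntzLE (matRep (K + 1) a) (matRep K b)) {ε : ℝ} (hε : 0 < ε) (F1 : Finset A) {ε1 : ℝ}
    (hε1 : 0 < ε1) {c : A} (hc : ∃ d, c = star d * d) (hc0 : c ≠ 0) :
    ∃ (γ : A →ₗ[ℂ] A) (q : A), IsCPC γ ∧ IsSelfAdjoint q ∧ q * q = q ∧ q ≠ 0 ∧
      (∀ x, γ x * q = 0) ∧ (∀ x ∈ F1, ‖q * x - x * q‖ ≤ ε1) ∧ CuntzLE (γ 1) c ∧
      ∃ u : Matrix (Fin n) (Fin n) A, MatPos u ∧ MatCuntzLE u b ∧ nrm (u + a.map γ - a) < ε := by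
  classical
  set N : ℝ := n * n * (2 * (1 + n * n * 6 + 1)) with hN
  have hN0 : 0 ≤ N := by positivity
  set δ := ε / (2 * (N + 1)) with hδ
  have hδ0 : 0 < δ := by positivity
  have hNδ : N * δ < ε / 2 := by
    rw [hδ, mul_div_assoc', div_lt_iff₀ (by positivity)]; nlinarith
  obtain ⟨F0, ε0, η, hε0, hη, H⟩ := transfer_alpha ha hb hK h hδ0
  obtain ⟨ε', hε', i1, i2, i3, i4, i5⟩ : ∃ ε' : ℝ, 0 < ε' ∧ ε' ≤ ε0 ∧ ε' ≤ η / (m * m + 1) ∧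
      ε' ≤ ε / (4 * (n * n + 1)) ∧ ε' ≤ ε1 / 2 ∧ ε' ≤ 1 / 2 := by
    refine ⟨min ε0 (min (η / (m * m + 1)) (min (ε / (4 * (n * n + 1))) (min (ε1 / 2) (1 / 2)))),
      by positivity, ?_, ?_, ?_, ?_, ?_⟩ <;> simp
  obtain ⟨B, hB, α, β, γ, hα, hβ, hγ, horth, hα1, hproj, h2, h3, h3', h4, h5⟩ :=
    hA ε' hε' (F0 ∪ entries b ∪ entries a ∪ F1 ∪ {1}) c hc hc0
  obtain ⟨U, hU⟩ := H B.carrier (hP B hB) α hα (fun x hx y hy =>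
    (h3 x (by simp [hx]) y (by simp [hy])).le.trans i1)
  have hBnt : (1 : B.carrier) ≠ 0 := by
    intro h0
    have := h3' 1 (by simp)
    rw [hα1, h0, norm_zero, CStarRing.norm_one] at this
    linarith
  have hev := transfer_beta ha hb hα hβ horth hproj (fun x y => (h4 x y).1) (ε := ε') (η := η)
    (δ := δ) (by
      rw [le_div_iff₀ (by positivity)] at i2
      nlinarith) hδ0 (D := δ + n * n * (6 * δ)) (by positivity)
    (fun i j k => (h2 _ (by simp [mem_entries]) k).le) U hU
  have hev2 : ∀ᶠ k in atTop, 0 < ‖β k 1‖ :=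
    (h4 1 1).2.eventually (lt_mem_nhds (norm_pos_iff.2 hBnt))
  obtain ⟨k, ⟨u, hu, hu2, hu3⟩, hk⟩ := (hev.and hev2).exists
  obtain ⟨hqq, hqs, -, -, hq1⟩ := hproj k
  refine ⟨γ k, β k 1, hγ k, hqs, hqq, norm_pos_iff.1 hk, fun x => (horth k x 1).1, ?_, h5 k,
    u, hu, hu3, ?_⟩
  · intro x hx
    have hx2 := h2 x (by simp [hx]) k
    set q := β k 1 with hq
    have hβq : ∀ x, β k x * q = β k x := by
      intro x
      have := (horth k 1 x).2
      rw [← eq_sub_iff_add_eq'] at hq1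
      rw [hq1, mul_sub, mul_one, sub_eq_zero] at this
      exact this.symm
    have hqβ : ∀ x, q * β k x = β k x := by
      intro x
      have := (horth k 1 x).1
      rw [← eq_sub_iff_add_eq'] at hq1
      rw [hq1, sub_mul, one_mul, sub_eq_zero] at this
      exact this.symm
    have hq1 : ‖q‖ ≤ 1 := by
      have h2 : ‖q‖ = ‖q‖ * ‖q‖ := by
        have := CStarRing.norm_star_mul_self (x := q)
        rw [hqs.star_eq, hqq] at this
        exact this
      nlinarith [norm_nonneg q]
    set z := x - γ k x - β k (α x) with hz
    have e : q * x - x * q = q * z - z * q := by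
      rw [hz, mul_sub, mul_sub, sub_mul, sub_mul, hqβ, hβq, hq, (horth k x 1).1, (horth k x 1).2]
      abel
    rw [e]
    calc ‖q * z - z * q‖ ≤ ‖q‖ * ‖z‖ + ‖z‖ * ‖q‖ :=
          (norm_sub_le _ _).trans (add_le_add (norm_mul_le _ _) (norm_mul_le _ _))
      _ ≤ 1 * ‖z‖ + ‖z‖ * 1 := by gcongr
      _ ≤ ε1 := by linarith
  · have n1 : nrm ((a.map α).map (β k) - (a - a.map (γ k))) ≤ n * n * ε' := by
      have := nrm_le_of_entry ((a.map α).map (β k) - (a - a.map (γ k))) (c := ε') (fun i j => by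
        have := (h2 (a i j) (by simp [mem_entries]) k).le
        rw [norm_sub_rev] at this
        simpa using this)
      simpa using this
    have t := nrm_sub_le u ((a.map α).map (β k)) (a - a.map (γ k))
    have e : u + a.map (γ k) - a = u - (a - a.map (γ k)) := by abel
    rw [e]
    have n2 : (n : ℝ) * n * ε' ≤ ε / 4 := by
      rw [le_div_iff₀ (by positivity)] at i3
      nlinarith
    have n3 : (n : ℝ) * n * (2 * (δ + n * n * (6 * δ) + δ)) = N * δ := by rw [hN]; ring
    linarith

theorem unperf_final {P : BundledCStarAlgebra → Prop}
    (hP : ∀ B : BundledCStarAlgebra, P B → AlmostUnperforatedW B.carrier)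
    (hs : IsSimpleCStarAlgebra A) (hA : AsympTraciallyIn P A) : AlmostUnperforatedW A := by
  intro n m a b ha hb k hk h
  have hcl : (k + 1) • cls a ≤ k • cls b := by
    rw [← cls_matRep, ← cls_matRep, cls_le]; exact h
  by_cases ha0 : a = 0
  · exact mle_of_eq 0 (by simp [ha0])
  by_cases hb0 : b = 0
  · rw [← cls_le]
    have h1 : cls a ≤ (k + 1) • cls a := by
      have := nsmul_le_nsmul_left (cls_nonneg (cls a)) (show 1 ≤ k + 1 by omega)
      rwa [one_smul] at this
    refine h1.trans (hcl.trans ?_)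
    rw [hb0, cls_zero, smul_zero]
  have hnt : Nontrivial A := by
    obtain ⟨i, hi⟩ := exists_diag ha ha0
    exact ⟨_, _, hi⟩
  by_cases hN : NonElem A
  · obtain ⟨b1, c, K, hb1, hc, hc0, hK, hK', hsum⟩ := ne_reduce hs hN ha ha0 hb hb0 hk hcl
    rw [← cls_matRep, ← cls_matRep, cls_le] at hK'
    have hc' : ∃ d, c = star d * d := by
      obtain ⟨d, hd⟩ := hc
      refine ⟨d () (), ?_⟩
      have := congrFun (congrFun hd ()) ()
      simpa [one1, Matrix.mul_apply, Matrix.conjTranspose_apply] using this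
    refine mle_closed fun ε hε => ?_
    obtain ⟨γ, q, hγ, -, -, -, -, -, hγc, u, hu, hub, hclose⟩ :=
      main_step hP hA ha hb1 hK hK' hε ∅ one_pos hc' hc0
    refine ⟨_, hclose, ?_⟩
    rw [← cls_le]
    refine (cls_add_le _ _).trans ((add_le_add (cls_le.2 hub) ?_).trans hsum)
    have p := cp_pos hγ (m_le_nrm (matPos_star ha) le_rfl)
    have e : ((nrm a : ℂ) • (1 : Matrix (Fin n) (Fin n) A) - a).map γ =
        (nrm a : ℂ) • (Matrix.diagonal fun _ => γ 1) - a.map γ := by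
      rw [lin_sub, lin_smul]
      congr 2
      ext i j
      simp only [Matrix.map_apply, Matrix.one_apply, Matrix.diagonal_apply]
      split_ifs <;> simp
    rw [e] at p
    refine (cls_le.2 (mle_of_le (cp_pos hγ ha) p)).trans
      ((cls_le.2 (mle_smul _ (nrm_nonneg a))).trans ?_)
    rw [cls_diag]
    exact nsmul_le_nsmul_right (cuntzLE_cls hγc) n
  · obtain ⟨F, ε1, hε1, HF⟩ := elem_case hs hN
    refine mle_closed fun ε hε => ?_
    obtain ⟨γ, q, hγ, hqs, hqq, hq0, hγq, hF, hγc, u, hu, hub, hclose⟩ :=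
      main_step hP hA ha hb hk h hε F hε1 (c := 1) ⟨1, by simp⟩ one_ne_zero
    have hq1 : q = 1 := (HF q hqs hqq hF).resolve_left hq0
    have hγ0 : a.map γ = 0 := by
      ext i j
      have := hγq (a i j)
      rw [hq1, mul_one] at this
      simpa using this
    rw [hγ0, add_zero] at hclose
    exact ⟨u, hclose, hub⟩

end BT

/-- If `P` is a class of stably finite unital C*-algebras whose Cuntz semigroups are
almost unperforated, then the Cuntz semigroup of every simple unital C*-algebra that is
asymptotically tracially in `P` is almost unperforated. -/
theorem almostUnperforated_of_asympTraciallyIn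
    (P : BundledCStarAlgebra → Prop)
    (hP : ∀ B : BundledCStarAlgebra, P B → StablyFinite B.carrier ∧ AlmostUnperforatedW B.carrier)
    (A : Type) [CStarAlgebra A]
    (hsimple : IsSimpleCStarAlgebra A)
    (hA : AsympTraciallyIn P A) :
    AlmostUnperforatedW A := by
  exact unperf_final (fun B hB => (hP B hB).2) hsimple hA
end

section
/- Let A be a unital C*-algebra with β-comparison for some real number 1 ≤ β < ∞, and let p ∈ A be a nonzero projection. Then the unital hereditary C*-subalgebra pAp has β-comparison. -/
open Filter Topology Matrix

/-- The hereditary corner `pAp` of a C*-algebra, as a non-unital star subalgebra. -/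
def cstarCorner {A : Type} [CStarAlgebra A] (p : A)
    (hp : IsIdempotentElem p) (hps : IsSelfAdjoint p) : NonUnitalStarSubalgebra ℂ A where
  carrier := {x | p * x * p = x}
  add_mem' := by
    intro x y hx hy
    simp only [Set.mem_setOf_eq] at *
    rw [mul_add, add_mul, hx, hy]
  zero_mem' := by simp
  mul_mem' := by
    intro x y hx hy
    simp only [Set.mem_setOf_eq] at *
    have hpx : p * x = x := by
      conv_lhs => rw [← hx]
      rw [← mul_assoc, ← mul_assoc, hp.eq]
      exact hx
    have hyp : y * p = y := by
      conv_lhs => rw [← hy]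
      rw [mul_assoc, hp.eq]
      exact hy
    calc p * (x * y) * p = (p * x) * (y * p) := by rw [mul_assoc, mul_assoc, mul_assoc]
    _ = x * y := by rw [hpx, hyp]
  smul_mem' := by
    intro c x hx
    simp only [Set.mem_setOf_eq] at *
    rw [mul_smul_comm, smul_mul_assoc, hx]
  star_mem' := by
    intro x hx
    simp only [Set.mem_setOf_eq] at *
    conv_rhs => rw [← hx]
    simp [StarMul.star_mul, hps.star_eq, mul_assoc]

/-- The compression `x ↦ p x p` onto the corner. -/
noncomputable def cornerCompress {A : Type} [CStarAlgebra A] (p : A)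
    (hp : IsIdempotentElem p) (hps : IsSelfAdjoint p) : A →+ cstarCorner p hp hps where
  toFun x := ⟨p * x * p, by
    change p * (p * x * p) * p = p * x * p
    have h : p * (p * x * p) * p = (p * p) * x * (p * p) := by simp only [mul_assoc]
    rw [h, hp.eq]⟩
  map_zero' := by ext; simp
  map_add' x y := by ext; simp [mul_add, add_mul]

theorem corner_left {A : Type} [CStarAlgebra A] (p : A)
    (hp : IsIdempotentElem p) (hps : IsSelfAdjoint p) (y : cstarCorner p hp hps) :
    p * (y : A) = y := by
  have hy : p * (y : A) * p = y := y.2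
  rw [← hy, ← mul_assoc, ← mul_assoc, hp.eq]

theorem corner_right {A : Type} [CStarAlgebra A] (p : A)
    (hp : IsIdempotentElem p) (hps : IsSelfAdjoint p) (y : cstarCorner p hp hps) :
    (y : A) * p = y := by
  have hy : p * (y : A) * p = y := y.2
  rw [← hy, mul_assoc, hp.eq]

theorem cornerCompress_coe {A : Type} [CStarAlgebra A] (p : A)
    (hp : IsIdempotentElem p) (hps : IsSelfAdjoint p) (y : cstarCorner p hp hps) :
    cornerCompress p hp hps (y : A) = y := Subtype.ext y.2

theorem cornerCompress_mul {A : Type} [CStarAlgebra A] (p : A)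
    (hp : IsIdempotentElem p) (hps : IsSelfAdjoint p) (x z : A) (y : cstarCorner p hp hps) :
    cornerCompress p hp hps (x * (y : A) * star z) =
      cornerCompress p hp hps x * y * star (cornerCompress p hp hps z) := by
  apply Subtype.ext
  change p * (x * (y : A) * star z) * p = p * x * p * (y : A) * star (p * z * p)
  have h1 : p * x * p * (y : A) = p * x * y := by
    rw [mul_assoc (p * x), corner_left]
  rw [h1]
  simp only [star_mul, hps.star_eq]
  have h2 : p * x * (y : A) * (p * (star z * p)) = p * x * ((y : A) * p) * (star z * p) := by
    simp only [mul_assoc]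
  rw [h2, corner_right]
  simp only [mul_assoc]

theorem cornerCompress_continuous {A : Type} [CStarAlgebra A] (p : A)
    (hp : IsIdempotentElem p) (hps : IsSelfAdjoint p) :
    Continuous (cornerCompress p hp hps) := by
  apply Continuous.subtype_mk
  fun_prop

/-- Cuntz subequivalence passes up from the corner to the algebra. -/
theorem matCuntzLE_up {A : Type} [CStarAlgebra A] (p : A)
    (hp : IsIdempotentElem p) (hps : IsSelfAdjoint p) {ι κ : Type} [Fintype ι] [Fintype κ]
    (a : Matrix ι ι (cstarCorner p hp hps)) (b : Matrix κ κ (cstarCorner p hp hps))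
    (h : MatCuntzLE a b) :
    MatCuntzLE (a.map (fun x => (x : A))) (b.map (fun x => (x : A))) := by
  obtain ⟨v, hv⟩ := h
  refine ⟨fun k => (v k).map (fun x => (x : A)), ?_⟩
  have hc : Continuous (fun M : Matrix ι ι (cstarCorner p hp hps) => M.map (fun x => (x : A))) :=
    continuous_id.matrix_map continuous_subtype_val
  refine ((hc.tendsto a).comp hv).congr fun k => ?_
  ext i j
  simp [Matrix.mul_apply]

/-- Cuntz subequivalence passes down from the algebra to the corner. -/
theorem matCuntzLE_down {A : Type} [CStarAlgebra A] (p : A)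
    (hp : IsIdempotentElem p) (hps : IsSelfAdjoint p) {ι κ : Type} [Fintype ι] [Fintype κ]
    (a : Matrix ι ι (cstarCorner p hp hps)) (b : Matrix κ κ (cstarCorner p hp hps))
    (h : MatCuntzLE (a.map (fun x => (x : A))) (b.map (fun x => (x : A)))) :
    MatCuntzLE a b := by
  obtain ⟨v, hv⟩ := h
  refine ⟨fun k => (v k).map (cornerCompress p hp hps), ?_⟩
  have hc : Continuous (fun M : Matrix ι ι A => M.map (cornerCompress p hp hps)) :=
    continuous_id.matrix_map (cornerCompress_continuous p hp hps)
  have ha : (a.map (fun x => (x : A))).map (cornerCompress p hp hps) = a := by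
    ext i j
    simp [cornerCompress_coe]
  have ht := (hc.tendsto (a.map (fun x => (x : A)))).comp hv
  rw [ha] at ht
  refine ht.congr fun k => ?_
  refine Matrix.ext fun i j => ?_
  simp only [Function.comp, Matrix.mul_apply, Matrix.map_apply, Matrix.conjTranspose_apply,
    Finset.sum_mul, map_sum, cornerCompress_mul]

theorem matPos_up {A : Type} [CStarAlgebra A] (p : A)
    (hp : IsIdempotentElem p) (hps : IsSelfAdjoint p) {ι : Type} [Fintype ι]
    (a : Matrix ι ι (cstarCorner p hp hps)) (h : MatPos a) :
    MatPos (a.map (fun x => (x : A))) := by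
  obtain ⟨c, rfl⟩ := h
  refine ⟨c.map (fun x => (x : A)), ?_⟩
  ext i j
  simp [Matrix.mul_apply]

theorem matRep_up {A : Type} [CStarAlgebra A] (p : A)
    (hp : IsIdempotentElem p) (hps : IsSelfAdjoint p) {ι : Type} (k : ℕ)
    (a : Matrix ι ι (cstarCorner p hp hps)) :
    (matRep k a).map (fun x => (x : A)) = matRep k (a.map (fun x => (x : A))) :=
  Matrix.blockDiagonal_map _ _ rfl

/-- If a unital C*-algebra `A` has `β`-comparison for some real `1 ≤ β < ∞` and `p ∈ A` is a
nonzero projection, then the unital hereditary C*-subalgebra `pAp` has `β`-comparison. -/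
theorem betaComparison_corner
    (A : Type) [CStarAlgebra A] (β : ℝ) (hβ : 1 ≤ β)
    (hA : BetaComparison A β)
    (p : A) (hp : IsIdempotentElem p) (hps : IsSelfAdjoint p) (hp0 : p ≠ 0) :
    BetaComparison (cstarCorner p hp hps) β := by
  intro n m k l hk hl hkl a b ha hb h
  apply matCuntzLE_down
  refine hA n m k l hk hl hkl _ _ (matPos_up p hp hps a ha) (matPos_up p hp hps b hb) ?_
  rw [← matRep_up, ← matRep_up]
  exact matCuntzLE_up p hp hps _ _ h
end
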